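/- Let L be a C^k (k ≥ 2) Tonelli Lagrangian on T𝕋ⁿ without conjugate points. For every T > 0 and r ∈ ℤⁿ, the function f : ℝⁿ → ℝ defined by f(x) = 𝒜_T(x, x+r) is constant. -/

import Mathlib

open MeasureTheory
open scoped NNReal

noncomputable section

abbrev E (n : ℕ) : Type := Fin n → ℝ

/-- The vector of `ℝⁿ` whose coordinates are the integers `m i`. -/
def intVec {n : ℕ} (m : Fin n → ℤ) : E n := fun i => (m i : ℝ)

/-- A Tonelli Lagrangian on `T𝕋ⁿ`, identified with a `ℤⁿ`-periodic (in `x`) function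
on `ℝⁿ × ℝⁿ` which is `Cᵏ`, uniformly superlinear in `v` and with positive definite
fiberwise Hessian. -/
structure IsTonelliLagrangian (n : ℕ) (k : ℕ∞) (L : E n × E n → ℝ) : Prop where
  smooth : ContDiff ℝ k L
  periodic : ∀ (x v : E n) (m : Fin n → ℤ), L (x + intVec m, v) = L (x, v)
  superlinear : ∀ C : ℝ, ∃ R : ℝ, ∀ (x v : E n), R ≤ ‖v‖ → C * ‖v‖ ≤ L (x, v)
  posdef : ∀ (x v w : E n), w ≠ 0 →
    0 < fderiv ℝ (fun v' => fderiv ℝ (fun v'' => L (x, v'')) v' w) v w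

/-- Partial differential of `L` in the fiber (velocity) direction. -/
def partialV (n : ℕ) (L : E n × E n → ℝ) (x v : E n) : E n →L[ℝ] ℝ :=
  fderiv ℝ (fun v' => L (x, v')) v

/-- Partial differential of `L` in the base (position) direction. -/
def partialX (n : ℕ) (L : E n × E n → ℝ) (x v : E n) : E n →L[ℝ] ℝ :=
  fderiv ℝ (fun x' => L (x', v)) x

/-- A `C²` curve satisfying the Euler–Lagrange equation
`d/dt (∂L/∂v(γ, γ')) = ∂L/∂x(γ, γ')`. -/
def IsExtremal (n : ℕ) (L : E n × E n → ℝ) (γ : ℝ → E n) : Prop :=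
  ContDiff ℝ 2 γ ∧
  ∀ t : ℝ, HasDerivAt (fun s => partialV n L (γ s) (deriv γ s))
    (partialX n L (γ t) (deriv γ t)) t

/-- `φ` is the (complete, `C^{k-1}`) Euler–Lagrange flow of `L` on `ℝⁿ × ℝⁿ`:
`φ t (x,v) = (γ t, γ' t)` where `γ` is the extremal curve with `(γ 0, γ' 0) = (x, v)`. -/
def IsELFlow (n : ℕ) (k : ℕ) (L : E n × E n → ℝ)
    (φ : ℝ → E n × E n → E n × E n) : Prop :=
  ContDiff ℝ ((k - 1 : ℕ) : ℕ∞) (fun p : ℝ × (E n × E n) => φ p.1 p.2) ∧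
  (∀ z : E n × E n, φ 0 z = z) ∧
  ∀ x v : E n, IsExtremal n L (fun t => (φ t (x, v)).1) ∧
    ∀ t : ℝ, (φ t (x, v)).2 = deriv (fun s => (φ s (x, v)).1) t

/-- The flow `φ` has no conjugate points: for `t ≠ 0` the image of the vertical
subspace `{0} × ℝⁿ` under `Dφ_t(z)` meets `{0} × ℝⁿ` only in `0`. -/
def NoConjugatePoints (n : ℕ) (φ : ℝ → E n × E n → E n × E n) : Prop :=
  ∀ (z : E n × E n) (t : ℝ), t ≠ 0 → ∀ w : E n,
    (fderiv ℝ (φ t) z (0, w)).1 = 0 → w = 0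

/-- The absolutely continuous curve starting at `x` with derivative `g`. -/
def curveOf (n : ℕ) (x : E n) (g : ℝ → E n) : ℝ → E n :=
  fun s => x + ∫ u in (0:ℝ)..s, g u

/-- `Acost n L t x y` = the infimum of the Lagrangian action over all absolutely
continuous curves `c : [0,t] → ℝⁿ` with `c 0 = x` and `c t = y`. -/
def Acost (n : ℕ) (L : E n × E n → ℝ) (t : ℝ) (x y : E n) : ℝ :=
  sInf { A : ℝ | ∃ g : ℝ → E n,
    IntervalIntegrable g volume 0 t ∧
    curveOf n x g t = y ∧
    IntervalIntegrable (fun s => L (curveOf n x g s, g s)) volume 0 t ∧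
    A = ∫ s in (0:ℝ)..t, L (curveOf n x g s, g s) }

section

open Set Filter Topology

section Lagrangian

variable {n : ℕ} {L : E n × E n → ℝ}

theorem partialV_eq_fderiv_comp (hL : ContDiff ℝ 2 L) (x v : E n) :
    partialV n L x v = (fderiv ℝ L (x, v)).comp (ContinuousLinearMap.inr ℝ (E n) (E n)) := by
  have h : HasFDerivAt L (fderiv ℝ L (x, v)) (x, v) :=
    (hL.differentiable (by norm_num) _).hasFDerivAt
  exact (h.comp v (hasFDerivAt_prodMk_right x v)).fderiv

theorem partialX_eq_fderiv_comp (hL : ContDiff ℝ 2 L) (x v : E n) :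
    partialX n L x v = (fderiv ℝ L (x, v)).comp (ContinuousLinearMap.inl ℝ (E n) (E n)) := by
  have h : HasFDerivAt L (fderiv ℝ L (x, v)) (x, v) :=
    (hL.differentiable (by norm_num) _).hasFDerivAt
  exact (h.comp x (hasFDerivAt_prodMk_left x v)).fderiv

theorem contDiff_partialV (hL : ContDiff ℝ 2 L) :
    ContDiff ℝ 1 (fun z : E n × E n => partialV n L z.1 z.2) := by
  simp only [partialV_eq_fderiv_comp hL, Prod.mk.eta]
  exact (hL.fderiv_right (m := 1) (by norm_num)).clm_comp contDiff_const

theorem contDiff_partialX (hL : ContDiff ℝ 2 L) :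
    ContDiff ℝ 1 (fun z : E n × E n => partialX n L z.1 z.2) := by
  simp only [partialX_eq_fderiv_comp hL, Prod.mk.eta]
  exact (hL.fderiv_right (m := 1) (by norm_num)).clm_comp contDiff_const

theorem fderiv_eq_partialX_add_partialV (hL : ContDiff ℝ 2 L) (x v a b : E n) :
    fderiv ℝ L (x, v) (a, b) = partialX n L x v a + partialV n L x v b := by
  rw [partialV_eq_fderiv_comp hL, partialX_eq_fderiv_comp hL]
  simp [← map_add]

theorem hasFDerivAt_lagrangian (hL : ContDiff ℝ 2 L) (x v : E n) :
    HasFDerivAt L ((partialX n L x v).coprod (partialV n L x v)) (x, v) := by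
  have h : (partialX n L x v).coprod (partialV n L x v) = fderiv ℝ L (x, v) :=
    ContinuousLinearMap.ext fun z => by
      simpa using (fderiv_eq_partialX_add_partialV hL x v z.1 z.2).symm
  rw [h]
  exact (hL.differentiable (by norm_num) (x, v)).hasFDerivAt

theorem differentiable_partialV (hL : ContDiff ℝ 2 L) (x : E n) :
    Differentiable ℝ (partialV n L x) :=
  ((contDiff_partialV hL).comp (contDiff_prodMk_right x)).differentiable (by norm_num)

theorem IsTonelliLagrangian.fderiv_partialV_pos (hL : IsTonelliLagrangian n 2 L)
    (x v : E n) {w : E n} (hw : w ≠ 0) : 0 < fderiv ℝ (partialV n L x) v w w := by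
  have h := hL.posdef x v w hw
  have h2 := ((differentiable_partialV hL.smooth x v).hasFDerivAt.clm_apply
    (hasFDerivAt_const w v)).fderiv
  change 0 < fderiv ℝ (fun v' => partialV n L x v' w) v w at h
  rw [h2] at h
  simpa using h

theorem IsTonelliLagrangian.strictMono_partialV (hL : IsTonelliLagrangian n 2 L)
    (x v : E n) {w : E n} (hw : w ≠ 0) :
    StrictMono (fun s : ℝ => partialV n L x (v + s • w) w) := by
  have hd : ∀ s : ℝ, HasDerivAt (fun s : ℝ => partialV n L x (v + s • w) w)
      (fderiv ℝ (partialV n L x) (v + s • w) w w) s := by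
    intro s
    have h1 : HasDerivAt (fun s : ℝ => v + s • w) w s := by
      simpa using ((hasDerivAt_id s).smul_const w).const_add v
    have h2 := (differentiable_partialV hL.smooth x (v + s • w)).hasFDerivAt.comp_hasDerivAt s h1
    simpa using h2.clm_apply (hasDerivAt_const s w)
  refine strictMono_of_deriv_pos fun s => ?_
  rw [(hd s).deriv]
  exact hL.fderiv_partialV_pos x _ hw

theorem IsTonelliLagrangian.partialV_injective (hL : IsTonelliLagrangian n 2 L) (x : E n) :
    Function.Injective (partialV n L x) := by
  intro v v' h
  by_contra hne
  have := hL.strictMono_partialV x v (sub_ne_zero.2 (Ne.symm hne)) zero_lt_one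
  simp [h] at this

theorem IsTonelliLagrangian.partialV_sub_le (hL : IsTonelliLagrangian n 2 L) (x v v' : E n) :
    partialV n L x v (v' - v) ≤ L (x, v') - L (x, v) := by
  rcases eq_or_ne v v' with rfl | hne
  · simp
  have hd : ∀ s : ℝ, HasDerivAt (fun s : ℝ => L (x, v + s • (v' - v)))
      (partialV n L x (v + s • (v' - v)) (v' - v)) s := by
    intro s
    have h1 : HasDerivAt (fun s : ℝ => (x, v + s • (v' - v))) (0, v' - v) s := by
      simpa using (hasDerivAt_const s x).prodMk
        (((hasDerivAt_id s).smul_const (v' - v)).const_add v)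
    have h2 := (hasFDerivAt_lagrangian hL.smooth x (v + s • (v' - v))).comp_hasDerivAt s h1
    rw [ContinuousLinearMap.coprod_apply, map_zero, zero_add] at h2
    exact h2
  obtain ⟨ξ, hξ, h⟩ := exists_hasDerivAt_eq_slope _ _ zero_lt_one
    (fun s _ => (hd s).continuousAt.continuousWithinAt) (fun s _ => hd s)
  have := (hL.strictMono_partialV x v (sub_ne_zero.2 (Ne.symm hne)) hξ.1).le
  simp only [h] at this
  simpa using this

/-- Every point of `ℝⁿ` has an integer translate in the unit ball of the sup norm. -/
theorem exists_intVec_add_norm_le (x : E n) : ∃ m : Fin n → ℤ, ‖x + intVec m‖ ≤ 1 := by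
  refine ⟨fun i => -⌊x i⌋, (pi_norm_le_iff_of_nonneg zero_le_one).2 fun i => ?_⟩
  have h1 := Int.floor_le (x i)
  have h2 := Int.lt_floor_add_one (x i)
  simp only [Pi.add_apply, intVec, Int.cast_neg, Real.norm_eq_abs, abs_le]
  constructor <;> linarith

theorem IsTonelliLagrangian.exists_norm_sub_le (hL : IsTonelliLagrangian n 2 L) :
    ∃ C : ℝ, 0 ≤ C ∧ ∀ x v : E n, ‖v‖ - C ≤ L (x, v) := by
  obtain ⟨R, hR⟩ := hL.superlinear 1
  obtain ⟨B, hB⟩ := ((isCompact_closedBall (0 : E n) 1).prod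
    (isCompact_closedBall (0 : E n) R)).exists_bound_of_continuousOn
      hL.smooth.continuous.continuousOn
  refine ⟨|R| + |B|, by positivity, fun x v => ?_⟩
  rcases le_total R ‖v‖ with h | h
  · have := hR x v h
    have := abs_nonneg R
    have := abs_nonneg B
    linarith
  · obtain ⟨m, hm⟩ := exists_intVec_add_norm_le x
    have := hB (x + intVec m, v) (by simp [hm, h])
    rw [hL.periodic, Real.norm_eq_abs, abs_le] at this
    have := le_abs_self R
    have := le_abs_self B
    linarith

theorem IsTonelliLagrangian.partialV_periodic (hL : IsTonelliLagrangian n 2 L) (x v : E n)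
    (m : Fin n → ℤ) : partialV n L (x + intVec m) v = partialV n L x v := by
  simp only [partialV, hL.periodic]

theorem IsTonelliLagrangian.partialX_periodic (hL : IsTonelliLagrangian n 2 L) (x v : E n)
    (m : Fin n → ℤ) : partialX n L (x + intVec m) v = partialX n L x v := by
  have h : (fun x' => L (x', v)) = fun x' => L (x' + intVec m, v) := by
    simp only [hL.periodic]
  unfold partialX
  rw [← fderiv_comp_add_right (f := fun x' => L (x', v)) (intVec m), ← h]

end Lagrangian

/-- An injective continuous endomorphism of a finite-dimensional space is invertible. -/
theorem ContinuousLinearMap.exists_equiv_of_injective {V : Type*} [NormedAddCommGroup V]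
    [NormedSpace ℝ V] [FiniteDimensional ℝ V] (f : V →L[ℝ] V) (hf : Function.Injective f) :
    ∃ e : V ≃L[ℝ] V, (e : V →L[ℝ] V) = f :=
  ⟨(LinearEquiv.ofInjectiveEndo (f : V →ₗ[ℝ] V) hf).toContinuousLinearEquiv, by ext; rfl⟩

/-- Coordinates of a linear form on `ℝⁿ` in the dual of the canonical basis. -/
def dualCoord (n : ℕ) : (E n →L[ℝ] ℝ) →L[ℝ] E n :=
  ContinuousLinearMap.pi fun i => ContinuousLinearMap.apply ℝ ℝ (Pi.single i (1 : ℝ) : E n)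

theorem dualCoord_injective (n : ℕ) : Function.Injective (dualCoord n) := by
  intro p q h
  refine ContinuousLinearMap.coe_injective (LinearMap.pi_ext' fun i => LinearMap.ext_ring ?_)
  exact congrFun h i

/-- The Legendre map `(x, v) ↦ (x, ∂L/∂v(x, v))`, in coordinates. -/
def legendre (n : ℕ) (L : E n × E n → ℝ) (z : E n × E n) : E n × E n :=
  (z.1, dualCoord n (partialV n L z.1 z.2))

section Uniqueness

variable {n : ℕ} {L : E n × E n → ℝ}

theorem contDiff_legendre (hL : ContDiff ℝ 2 L) : ContDiff ℝ 1 (legendre n L) :=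
  contDiff_fst.prodMk ((dualCoord n).contDiff.comp (contDiff_partialV hL))

theorem IsTonelliLagrangian.legendre_injective (hL : IsTonelliLagrangian n 2 L) :
    Function.Injective (legendre n L) := by
  rintro ⟨x, v⟩ ⟨x', v'⟩ h
  obtain ⟨rfl, h2⟩ := Prod.mk.inj h
  exact Prod.ext rfl (hL.partialV_injective x (dualCoord_injective n h2))

theorem IsTonelliLagrangian.fderiv_legendre_injective (hL : IsTonelliLagrangian n 2 L)
    (z : E n × E n) : Function.Injective (fderiv ℝ (legendre n L) z) := by
  have hP := ((contDiff_partialV hL.smooth).differentiable one_ne_zero z).hasFDerivAt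
  have hd := (hasFDerivAt_fst (𝕜 := ℝ) (p := z)).prodMk ((dualCoord n).hasFDerivAt.comp z hP)
  change HasFDerivAt (legendre n L) _ z at hd
  rw [hd.fderiv]
  refine (injective_iff_map_eq_zero _).2 fun ⟨a, b⟩ hab => ?_
  simp only [ContinuousLinearMap.prod_apply, ContinuousLinearMap.coe_fst', Prod.mk_eq_zero,
    ContinuousLinearMap.comp_apply] at hab
  obtain ⟨rfl, h2⟩ := hab
  have h3 := dualCoord_injective n (h2.trans (map_zero _).symm)
  have h4 : fderiv ℝ (partialV n L z.1) z.2 b = 0 := by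
    have := (HasFDerivAt.comp z.2 (f := fun v => (z.1, v)) hP
      (hasFDerivAt_prodMk_right z.1 z.2)).fderiv
    change fderiv ℝ (partialV n L z.1) z.2 = _ at this
    rw [this]
    simpa using h3
  by_contra hne
  have hb : b ≠ 0 := fun hb => hne (by simp [hb])
  have := hL.fderiv_partialV_pos z.1 z.2 hb
  simp [h4] at this

theorem IsExtremal.hasDerivAt_legendre {γ : ℝ → E n} (hγ : IsExtremal n L γ) (t : ℝ) :
    HasDerivAt (fun s => legendre n L (γ s, deriv γ s))
      (deriv γ t, dualCoord n (partialX n L (γ t) (deriv γ t))) t :=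
  ((hγ.1.differentiable two_ne_zero t).hasDerivAt).prodMk
    ((dualCoord n).hasFDerivAt.comp_hasDerivAt t (hγ.2 t))

theorem IsExtremal.continuous_state {γ : ℝ → E n} (hγ : IsExtremal n L γ) :
    Continuous fun s => (γ s, deriv γ s) :=
  hγ.1.continuous.prodMk (hγ.1.continuous_deriv (by norm_num))

/-- Extremals are determined by their position and velocity at one time. -/
theorem IsExtremal.eq_of_eq (hL : IsTonelliLagrangian n 2 L) {γ₁ γ₂ : ℝ → E n}
    (h₁ : IsExtremal n L γ₁) (h₂ : IsExtremal n L γ₂) (t₀ : ℝ) (h : γ₁ t₀ = γ₂ t₀)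
    (h' : deriv γ₁ t₀ = deriv γ₂ t₀) : γ₁ = γ₂ := by
  have hopen : IsOpen {t | (γ₁ t, deriv γ₁ t) = (γ₂ t, deriv γ₂ t)} := by
    refine isOpen_iff_mem_nhds.2 fun t ht => ?_
    set z := (γ₁ t, deriv γ₁ t) with hz
    obtain ⟨e, he⟩ := (fderiv ℝ (legendre n L) z).exists_equiv_of_injective
      (hL.fderiv_legendre_injective z)
    have hC : ContDiffAt ℝ 1 (legendre n L) z := (contDiff_legendre hL.smooth).contDiffAt
    have hF : HasFDerivAt (legendre n L) (e : E n × E n →L[ℝ] E n × E n) z := by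
      rw [he]
      exact (hC.differentiableAt one_ne_zero).hasFDerivAt
    set G := hC.localInverse hF one_ne_zero with hG
    have hGC : ContDiffAt ℝ 1 G (legendre n L z) := hC.to_localInverse hF one_ne_zero
    have hGz : G (legendre n L z) = z := hC.localInverse_apply_image hF one_ne_zero
    have hGL : ∀ᶠ y in 𝓝 z, G (legendre n L y) = y :=
      (hC.hasStrictFDerivAt' hF one_ne_zero).eventually_left_inverse
    set X : E n × E n → E n × E n := fun Z =>
      ((G Z).2, dualCoord n (partialX n L (G Z).1 (G Z).2)) with hX
    have hXC : ContDiffAt ℝ 1 X (legendre n L z) :=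
      (contDiff_snd.contDiffAt.comp _ hGC).prodMk ((dualCoord n).contDiff.contDiffAt.comp _
        ((contDiff_partialX hL.smooth).contDiffAt.comp _ hGC))
    obtain ⟨K, s, hs, hK⟩ := hXC.exists_lipschitzOnWith
    have key : ∀ γ : ℝ → E n, IsExtremal n L γ → (γ t, deriv γ t) = z →
        ∀ᶠ u in 𝓝 t, HasDerivAt (fun s => legendre n L (γ s, deriv γ s))
          (X (legendre n L (γ u, deriv γ u))) u ∧ legendre n L (γ u, deriv γ u) ∈ s := by
      intro γ hγ hγz
      have hc := hγ.continuous_state.tendsto t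
      rw [hγz] at hc
      have hc' := ((contDiff_legendre hL.smooth).continuous.tendsto z).comp hc
      filter_upwards [hc.eventually hGL, hc'.eventually hs] with u hu hu'
      refine ⟨?_, hu'⟩
      simp only [hX, hu]
      exact hγ.hasDerivAt_legendre u
    have huniq := ODE_solution_unique_of_eventually (v := fun _ => X) (s := fun _ => s)
      (Eventually.of_forall fun _ => hK) (key γ₁ h₁ hz.symm) (key γ₂ h₂ ht.symm)
      (congrArg (legendre n L) (hz.symm.trans ht))
    filter_upwards [huniq] with u hu
    exact hL.legendre_injective hu
  have hclosed : IsClosed {t | (γ₁ t, deriv γ₁ t) = (γ₂ t, deriv γ₂ t)} :=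
    isClosed_eq h₁.continuous_state h₂.continuous_state
  have huniv := IsClopen.eq_univ ⟨hclosed, hopen⟩ ⟨t₀, Prod.ext h h'⟩
  funext t
  have ht : t ∈ {t | (γ₁ t, deriv γ₁ t) = (γ₂ t, deriv γ₂ t)} := huniv ▸ mem_univ t
  exact congrArg Prod.fst ht

theorem deriv_comp_add_right (γ : ℝ → E n) (s : ℝ) :
    deriv (fun t => γ (t + s)) = fun t => deriv γ (t + s) :=
  funext fun t => _root_.deriv_comp_add_const γ s t

theorem IsExtremal.comp_add_right {γ : ℝ → E n} (hγ : IsExtremal n L γ) (s : ℝ) :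
    IsExtremal n L fun t => γ (t + s) := by
  refine ⟨hγ.1.comp (contDiff_id.add contDiff_const), fun t => ?_⟩
  simp only [deriv_comp_add_right]
  exact (hγ.2 (t + s)).comp_add_const t s

theorem IsExtremal.add_intVec (hL : IsTonelliLagrangian n 2 L) {γ : ℝ → E n}
    (hγ : IsExtremal n L γ) (m : Fin n → ℤ) : IsExtremal n L fun t => γ t + intVec m := by
  refine ⟨hγ.1.add contDiff_const, fun t => ?_⟩
  have hd : deriv (fun t => γ t + intVec m) = deriv γ := funext fun t => deriv_add_const _
  simp only [hd, hL.partialV_periodic, hL.partialX_periodic]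
  exact hγ.2 t

variable {φ : ℝ → E n × E n → E n × E n}

theorem IsELFlow.eq_state (hL : IsTonelliLagrangian n 2 L) (hφ : IsELFlow n 2 L φ)
    {γ : ℝ → E n} (hγ : IsExtremal n L γ) (t : ℝ) :
    φ t (γ 0, deriv γ 0) = (γ t, deriv γ t) := by
  obtain ⟨h1, h2⟩ := hφ.2.2 (γ 0) (deriv γ 0)
  have h0 := hφ.2.1 (γ 0, deriv γ 0)
  have heq := h1.eq_of_eq hL hγ 0 (by simp [h0]) (by rw [← h2 0, h0])
  refine Prod.ext (congrFun heq t) ?_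
  rw [h2 t, heq]

theorem IsELFlow.add (hL : IsTonelliLagrangian n 2 L) (hφ : IsELFlow n 2 L φ)
    (t s : ℝ) (z : E n × E n) : φ (t + s) z = φ t (φ s z) := by
  obtain ⟨h1, h2⟩ := hφ.2.2 z.1 z.2
  have h := hφ.eq_state hL (h1.comp_add_right s) t
  have hd := deriv_comp_add_right (fun u => (φ u (z.1, z.2)).1) s
  simp only [hd, ← h2, zero_add] at h
  exact h.symm

end Uniqueness

/-- Differentiation under the integral sign for integrands that are `C¹` in the parameter. -/
theorem hasFDerivAt_intervalIntegral_of_continuous {V W : Type*} [NormedAddCommGroup V]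
    [NormedSpace ℝ V] [FiniteDimensional ℝ V] [NormedAddCommGroup W] [NormedSpace ℝ W]
    {g : ℝ × V → W} {g' : ℝ × V → V →L[ℝ] W} (hg : Continuous g) (hg' : Continuous g')
    (hd : ∀ s v, HasFDerivAt (fun v => g (s, v)) (g' (s, v)) v) (a b : ℝ) (v : V) :
    HasFDerivAt (fun v => ∫ s in a..b, g (s, v)) (∫ s in a..b, g' (s, v)) v := by
  obtain ⟨B, hB⟩ := ((isCompact_uIcc (a := a) (b := b)).prod
    (isCompact_closedBall v 1)).exists_bound_of_continuousOn hg'.continuousOn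
  refine intervalIntegral.hasFDerivAt_integral_of_dominated_of_fderiv_le
    (F := fun v s => g (s, v)) (F' := fun v s => g' (s, v)) (bound := fun _ => B)
    (Metric.closedBall_mem_nhds v one_pos) (Eventually.of_forall fun w => ?_) ?_ ?_
    (Eventually.of_forall fun t ht w hw => hB (t, w) ⟨uIoc_subset_uIcc ht, hw⟩) ?_
    (Eventually.of_forall fun t _ w _ => hd t w)
  · exact (hg.comp (.prodMk_left w)).aestronglyMeasurable
  · exact (hg.comp (.prodMk_left v)).intervalIntegrable a b
  · exact (hg'.comp (.prodMk_left v)).aestronglyMeasurable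
  · exact continuous_const.intervalIntegrable a b

/-- The state at time `p.1` of the extremal starting at `x` with velocity `p.2`. -/
def stateMap {n : ℕ} (φ : ℝ → E n × E n → E n × E n) (x : E n) (p : ℝ × E n) : E n × E n :=
  φ p.1 (x, p.2)

/-- The derivative of `stateMap` with respect to the initial velocity. -/
def stateJac {n : ℕ} (φ : ℝ → E n × E n → E n × E n) (x : E n) (p : ℝ × E n) :
    E n →L[ℝ] E n × E n :=
  (fderiv ℝ (stateMap φ x) p).comp (ContinuousLinearMap.inr ℝ ℝ (E n))

/-- The derivative of the position component of `stateMap` with respect to the initial velocity. -/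
def expJac {n : ℕ} (φ : ℝ → E n × E n → E n × E n) (x : E n) (p : ℝ × E n) : E n →L[ℝ] E n :=
  (ContinuousLinearMap.fst ℝ (E n) (E n)).comp (stateJac φ x p)

/-- The action on `[0, p.1]` of the extremal starting at `x` with velocity `p.2`. -/
def radialAction {n : ℕ} (L : E n × E n → ℝ) (φ : ℝ → E n × E n → E n × E n) (x : E n)
    (p : ℝ × E n) : ℝ :=
  ∫ s in (0:ℝ)..p.1, L (stateMap φ x (s, p.2))

section Radial

variable {n : ℕ} {L : E n × E n → ℝ} {φ : ℝ → E n × E n → E n × E n}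

theorem IsELFlow.contDiff_stateMap (hφ : IsELFlow n 2 L φ) (x : E n) :
    ContDiff ℝ 1 (stateMap φ x) :=
  hφ.1.comp (contDiff_fst.prodMk (contDiff_const.prodMk contDiff_snd))

theorem IsELFlow.continuous_stateMap (hφ : IsELFlow n 2 L φ) (x : E n) :
    Continuous (stateMap φ x) :=
  (hφ.contDiff_stateMap x).continuous

theorem IsELFlow.continuous_stateJac (hφ : IsELFlow n 2 L φ) (x : E n) :
    Continuous (stateJac φ x) :=
  ((hφ.contDiff_stateMap x).continuous_fderiv one_ne_zero).clm_comp continuous_const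

theorem IsELFlow.continuous_expJac (hφ : IsELFlow n 2 L φ) (x : E n) :
    Continuous (expJac φ x) :=
  continuous_const.clm_comp (hφ.continuous_stateJac x)

theorem IsELFlow.hasFDerivAt_stateMap (hφ : IsELFlow n 2 L φ) (x : E n) (t : ℝ) (v : E n) :
    HasFDerivAt (fun v => stateMap φ x (t, v)) (stateJac φ x (t, v)) v :=
  (((hφ.contDiff_stateMap x).differentiable one_ne_zero (t, v)).hasFDerivAt).comp v
    (hasFDerivAt_prodMk_right t v)

theorem IsELFlow.hasFDerivAt_stateMap_fst (hφ : IsELFlow n 2 L φ) (x : E n) (t : ℝ) (v : E n) :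
    HasFDerivAt (fun v => (stateMap φ x (t, v)).1) (expJac φ x (t, v)) v :=
  (ContinuousLinearMap.fst ℝ (E n) (E n)).hasFDerivAt.comp v (hφ.hasFDerivAt_stateMap x t v)

theorem IsELFlow.hasDerivAt_stateMap_fst (hφ : IsELFlow n 2 L φ) (x : E n) (t : ℝ) (v : E n) :
    HasDerivAt (fun t => (stateMap φ x (t, v)).1) (stateMap φ x (t, v)).2 t := by
  obtain ⟨h1, h2⟩ := hφ.2.2 x v
  have := (h1.1.differentiable two_ne_zero t).hasDerivAt
  rw [← h2 t] at this
  exact this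

theorem IsELFlow.stateMap_zero (hφ : IsELFlow n 2 L φ) (x v : E n) :
    stateMap φ x (0, v) = (x, v) :=
  hφ.2.1 (x, v)

theorem IsELFlow.hasDerivAt_partialV (hφ : IsELFlow n 2 L φ) (x : E n) (t : ℝ) (v : E n) :
    HasDerivAt (fun t => partialV n L (stateMap φ x (t, v)).1 (stateMap φ x (t, v)).2)
      (partialX n L (stateMap φ x (t, v)).1 (stateMap φ x (t, v)).2) t := by
  obtain ⟨h1, h2⟩ := hφ.2.2 x v
  have := h1.2 t
  simp only [← h2] at this
  exact this

theorem IsELFlow.stateMap_fst_eq (hφ : IsELFlow n 2 L φ) (x : E n) (t : ℝ) (v : E n) :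
    (stateMap φ x (t, v)).1 = x + ∫ s in (0:ℝ)..t, (stateMap φ x (s, v)).2 := by
  have hc : Continuous fun s => (stateMap φ x (s, v)).2 :=
    continuous_snd.comp ((hφ.continuous_stateMap x).comp (.prodMk_left v))
  rw [intervalIntegral.integral_eq_sub_of_hasDerivAt
    (fun s _ => hφ.hasDerivAt_stateMap_fst x s v) (hc.intervalIntegrable 0 t),
    hφ.stateMap_zero, add_sub_cancel]

theorem IsELFlow.expJac_eq (hφ : IsELFlow n 2 L φ) (x : E n) (t : ℝ) (v : E n) :
    expJac φ x (t, v) = ∫ s in (0:ℝ)..t,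
      (ContinuousLinearMap.snd ℝ (E n) (E n)).comp (stateJac φ x (s, v)) := by
  have h := (hasFDerivAt_intervalIntegral_of_continuous
    (g := fun p => (stateMap φ x p).2)
    (g' := fun p => (ContinuousLinearMap.snd ℝ (E n) (E n)).comp (stateJac φ x p))
    (continuous_snd.comp (hφ.continuous_stateMap x))
    (continuous_const.clm_comp (hφ.continuous_stateJac x))
    (fun s v => (ContinuousLinearMap.snd ℝ (E n) (E n)).hasFDerivAt.comp v
      (hφ.hasFDerivAt_stateMap x s v)) 0 t v).const_add x
  simp only [← hφ.stateMap_fst_eq x t] at h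
  exact (hφ.hasFDerivAt_stateMap_fst x t v).unique h

theorem IsELFlow.hasDerivAt_expJac (hφ : IsELFlow n 2 L φ) (x : E n) (t : ℝ) (v : E n) :
    HasDerivAt (fun t => expJac φ x (t, v))
      ((ContinuousLinearMap.snd ℝ (E n) (E n)).comp (stateJac φ x (t, v))) t := by
  simp only [hφ.expJac_eq]
  have hc : Continuous fun s => (ContinuousLinearMap.snd ℝ (E n) (E n)).comp
      (stateJac φ x (s, v)) :=
    continuous_const.clm_comp ((hφ.continuous_stateJac x).comp (.prodMk_left v))
  exact intervalIntegral.integral_hasDerivAt_right (hc.intervalIntegrable 0 t)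
    (hc.stronglyMeasurableAtFilter _ _) hc.continuousAt

/-- First variation formula: the differential of the action in the initial velocity. -/
theorem IsELFlow.hasFDerivAt_radialAction (hL : ContDiff ℝ 2 L) (hφ : IsELFlow n 2 L φ)
    (x : E n) (t : ℝ) (v : E n) :
    HasFDerivAt (fun v => radialAction L φ x (t, v))
      ((partialV n L (stateMap φ x (t, v)).1 (stateMap φ x (t, v)).2).comp
        (expJac φ x (t, v))) v := by
  have hcD : Continuous fun p => (fderiv ℝ L (stateMap φ x p)).comp (stateJac φ x p) :=
    ((hL.continuous_fderiv two_ne_zero).comp (hφ.continuous_stateMap x)).clm_comp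
      (hφ.continuous_stateJac x)
  have h := hasFDerivAt_intervalIntegral_of_continuous
    (g := fun p => L (stateMap φ x p))
    (g' := fun p => (fderiv ℝ L (stateMap φ x p)).comp (stateJac φ x p))
    (hL.continuous.comp (hφ.continuous_stateMap x)) hcD
    (fun s v => ((hL.differentiable two_ne_zero _).hasFDerivAt).comp v
      (hφ.hasFDerivAt_stateMap x s v)) 0 t v
  have hd : ∀ s : ℝ, HasDerivAt (fun s => (partialV n L (stateMap φ x (s, v)).1
      (stateMap φ x (s, v)).2).comp (expJac φ x (s, v)))
      ((fderiv ℝ L (stateMap φ x (s, v))).comp (stateJac φ x (s, v))) s := by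
    intro s
    have h1 := (hφ.hasDerivAt_partialV x s v).clm_comp (hφ.hasDerivAt_expJac x s v)
    have h2 : (fderiv ℝ L (stateMap φ x (s, v))).comp (stateJac φ x (s, v)) =
        (partialX n L (stateMap φ x (s, v)).1 (stateMap φ x (s, v)).2).comp (expJac φ x (s, v)) +
        (partialV n L (stateMap φ x (s, v)).1 (stateMap φ x (s, v)).2).comp
          ((ContinuousLinearMap.snd ℝ (E n) (E n)).comp (stateJac φ x (s, v))) := by
      ext1 w
      exact fderiv_eq_partialX_add_partialV hL _ _ (stateJac φ x (s, v) w).1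
        (stateJac φ x (s, v) w).2
    rw [h2]
    exact h1
  rw [intervalIntegral.integral_eq_sub_of_hasDerivAt (fun s _ => hd s)
    ((hcD.comp (.prodMk_left v)).intervalIntegrable 0 t)] at h
  have h0 : expJac φ x (0, v) = 0 := by simp [hφ.expJac_eq]
  rw [h0, ContinuousLinearMap.comp_zero, sub_zero] at h
  exact h

theorem IsELFlow.hasStrictFDerivAt_radialAction (hL : ContDiff ℝ 2 L) (hφ : IsELFlow n 2 L φ)
    (x : E n) (p : ℝ × E n) :
    HasStrictFDerivAt (radialAction L φ x)
      (((1 : ℝ →L[ℝ] ℝ).smulRight (L (stateMap φ x p))).coprod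
        ((partialV n L (stateMap φ x p).1 (stateMap φ x p).2).comp (expJac φ x p))) p := by
  have hc := hφ.continuous_stateMap x
  have hcL : Continuous fun p => L (stateMap φ x p) := hL.continuous.comp hc
  refine hasStrictFDerivAt_uncurry_coprod (𝕜 := ℝ) (f := fun t v => radialAction L φ x (t, v))
    (f₁ := fun t v => (1 : ℝ →L[ℝ] ℝ).smulRight (L (stateMap φ x (t, v))))
    (f₂ := fun t v => (partialV n L (stateMap φ x (t, v)).1 (stateMap φ x (t, v)).2).comp
        (expJac φ x (t, v)))
    (Eventually.of_forall fun q => ?_)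
    (Eventually.of_forall fun q => hφ.hasFDerivAt_radialAction hL x q.1 q.2) ?_ ?_
  · have hc' : Continuous fun s => L (stateMap φ x (s, q.2)) := hcL.comp (.prodMk_left q.2)
    exact (intervalIntegral.integral_hasDerivAt_right (hc'.intervalIntegrable 0 q.1)
      (hc'.stronglyMeasurableAtFilter _ _) hc'.continuousAt).hasFDerivAt
  · exact ((ContinuousLinearMap.smulRightL ℝ ℝ ℝ 1).continuous.comp hcL).continuousAt
  · exact (((contDiff_partialV hL).continuous.comp hc).clm_comp
      (hφ.continuous_expJac x)).continuousAt

theorem IsELFlow.hasStrictFDerivAt_stateMap_fst (hφ : IsELFlow n 2 L φ) (x : E n)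
    (p : ℝ × E n) :
    HasStrictFDerivAt (fun p => (stateMap φ x p).1)
      (((1 : ℝ →L[ℝ] ℝ).smulRight (stateMap φ x p).2).coprod (expJac φ x p)) p := by
  have hs := (contDiff_fst.comp (hφ.contDiff_stateMap x)).contDiffAt.hasStrictFDerivAt (x := p)
    one_ne_zero
  have heq : ((1 : ℝ →L[ℝ] ℝ).smulRight (stateMap φ x p).2).coprod (expJac φ x p) =
      fderiv ℝ (Prod.fst ∘ stateMap φ x) p := by
    have hd := hs.hasFDerivAt
    have h1 : HasDerivAt (fun t => (stateMap φ x (t, p.2)).1) _ p.1 :=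
      HasFDerivAt.comp_hasDerivAt p.1 (f := fun t => (t, p.2)) hd
        ((hasDerivAt_id p.1).prodMk (hasDerivAt_const p.1 p.2))
    have h2 : HasFDerivAt (fun v => (stateMap φ x (p.1, v)).1) _ p.2 :=
      HasFDerivAt.comp p.2 (f := fun v => (p.1, v)) hd (hasFDerivAt_prodMk_right p.1 p.2)
    have h1' := h1.unique (hφ.hasDerivAt_stateMap_fst x p.1 p.2)
    have h2' := h2.unique (hφ.hasFDerivAt_stateMap_fst x p.1 p.2)
    refine ContinuousLinearMap.ext fun ⟨s, w⟩ => ?_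
    have h3 : ((s, w) : ℝ × E n) = s • ((1 : ℝ), (0 : E n)) + (0, w) := by simp
    rw [h3, map_add, map_add, map_smul, map_smul]
    congr 1
    · simpa using congrArg (s • ·) h1'.symm
    · simpa using (DFunLike.congr_fun h2' w).symm
  rw [heq]
  exact hs

theorem IsELFlow.expJac_injective (hφ : IsELFlow n 2 L φ) (hnc : NoConjugatePoints n φ)
    (x : E n) {p : ℝ × E n} (hp : p.1 ≠ 0) : Function.Injective (expJac φ x p) := by
  refine (injective_iff_map_eq_zero _).2 fun w hw => hnc (x, p.2) p.1 hp w ?_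
  have hd : DifferentiableAt ℝ (φ p.1) (x, p.2) :=
    (hφ.1.comp (contDiff_prodMk_right p.1)).differentiable one_ne_zero _
  have h := HasFDerivAt.comp p.2 (f := fun v => (x, v)) hd.hasFDerivAt
    (hasFDerivAt_prodMk_right x p.2)
  have := (hφ.hasFDerivAt_stateMap x p.1 p.2).unique h
  exact (congrArg Prod.fst (DFunLike.congr_fun this w).symm).trans hw

end Radial

section Hadamard

variable {n : ℕ} {L : E n × E n → ℝ} {φ : ℝ → E n × E n → E n × E n}

/-- A bound on the action of extremals from `x` bounds their initial velocity. -/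
theorem IsELFlow.exists_norm_le_of_radialAction_le (hL : IsTonelliLagrangian n 2 L)
    (hφ : IsELFlow n 2 L φ) (x : E n) {a : ℝ} (ha : 0 < a) (b C : ℝ) :
    ∃ R : ℝ, ∀ t v, a ≤ t → t ≤ b → radialAction L φ x (t, v) ≤ C → ‖v‖ ≤ R := by
  obtain ⟨C', hC', hLC⟩ := hL.exists_norm_sub_le
  set M := C + C' * b
  obtain ⟨R, hR⟩ := ((isCompact_Icc (a := -b) (b := 0)).prod
    ((isCompact_closedBall x M).prod (isCompact_closedBall (0 : E n) (M / a)))).exists_bound_of_continuousOn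
    (f := fun p : ℝ × (E n × E n) => φ p.1 p.2) hφ.1.continuous.continuousOn
  refine ⟨R, fun t v hat htb hA => ?_⟩
  have ht : 0 < t := ha.trans_le hat
  have hc := (hφ.continuous_stateMap x).comp (Continuous.prodMk_left v)
  have hv : Continuous fun s => (stateMap φ x (s, v)).2 := continuous_snd.comp hc
  have hM : ∫ s in (0:ℝ)..t, ‖(stateMap φ x (s, v)).2‖ ≤ M := by
    have h1 : ∫ s in (0:ℝ)..t, (‖(stateMap φ x (s, v)).2‖ - C') ≤ radialAction L φ x (t, v) :=
      intervalIntegral.integral_mono ht.le ((hv.norm.sub continuous_const).intervalIntegrable _ _)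
        ((hL.smooth.continuous.comp hc).intervalIntegrable _ _) fun s => hLC _ _
    rw [intervalIntegral.integral_sub (hv.norm.intervalIntegrable _ _)
      (continuous_const.intervalIntegrable _ _)] at h1
    simp only [intervalIntegral.integral_const, smul_eq_mul, sub_zero] at h1
    have : t * C' ≤ C' * b := by nlinarith
    simp only [M]
    linarith
  obtain ⟨s, hs, hsv⟩ : ∃ s ∈ Icc 0 t, ‖(stateMap φ x (s, v)).2‖ ≤ M / a := by
    by_contra! hcon
    have h1 : ∫ _ in (0:ℝ)..t, M / a < ∫ s in (0:ℝ)..t, ‖(stateMap φ x (s, v)).2‖ :=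
      intervalIntegral.integral_lt_integral_of_continuousOn_of_le_of_exists_lt ht
        continuousOn_const hv.norm.continuousOn (fun s hs => (hcon s (Ioc_subset_Icc_self hs)).le)
        ⟨0, left_mem_Icc.2 ht.le, hcon 0 (left_mem_Icc.2 ht.le)⟩
    simp only [intervalIntegral.integral_const, smul_eq_mul, sub_zero] at h1
    have hM0 : 0 ≤ M := (intervalIntegral.integral_nonneg ht.le fun _ _ => norm_nonneg _).trans hM
    have : M ≤ t * (M / a) := by
      rw [mul_div_assoc', le_div_iff₀ ha]
      nlinarith
    linarith
  have hsx : ‖(stateMap φ x (s, v)).1 - x‖ ≤ M := by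
    rw [hφ.stateMap_fst_eq, add_sub_cancel_left]
    refine (intervalIntegral.norm_integral_le_integral_norm hs.1).trans (le_trans ?_ hM)
    exact intervalIntegral.integral_mono_interval le_rfl hs.1 hs.2
      (Eventually.of_forall fun _ => norm_nonneg _) (hv.norm.intervalIntegrable _ _)
  have h := hR (-s, stateMap φ x (s, v)) ⟨⟨by linarith [hs.2], by linarith [hs.1]⟩,
    by simpa [dist_eq_norm] using hsx, by simpa using hsv⟩
  have hadd := hφ.add hL (-s) s (x, v)
  rw [neg_add_cancel, hφ.2.1] at hadd
  simp only [stateMap, ← hadd] at h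
  exact (le_max_right _ _).trans h

/-- The map `(s, v) ↦ (s, γ_v (θ s))`, where `γ_v` is the extremal from `x` with velocity `v`. -/
def expMap (φ : ℝ → E n × E n → E n × E n) (x : E n) (θ : ℝ → ℝ) (p : ℝ × E n) : ℝ × E n :=
  (p.1, (stateMap φ x (θ p.1, p.2)).1)

theorem IsELFlow.exists_hasStrictFDerivAt_expMap (hφ : IsELFlow n 2 L φ)
    (hnc : NoConjugatePoints n φ) (x : E n) {θ : ℝ → ℝ} {θ' s : ℝ} (hθ : HasStrictDerivAt θ θ' s)
    (hs : θ s ≠ 0) (v : E n) : ∃ e : (ℝ × E n) ≃L[ℝ] (ℝ × E n),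
      (∀ p, e p = (p.1, (θ' * p.1) • (stateMap φ x (θ s, v)).2 + expJac φ x (θ s, v) p.2)) ∧
      HasStrictFDerivAt (expMap φ x θ) (e : (ℝ × E n) →L[ℝ] (ℝ × E n)) (s, v) := by
  have h1 : HasStrictFDerivAt (fun p : ℝ × E n => (θ p.1, p.2)) _ (s, v) :=
    (HasStrictFDerivAt.comp (s, v) (f := Prod.fst) hθ.hasStrictFDerivAt
      hasStrictFDerivAt_fst).prodMk hasStrictFDerivAt_snd
  obtain ⟨D, hD, hap⟩ : ∃ D : (ℝ × E n) →L[ℝ] (ℝ × E n),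
      HasStrictFDerivAt (expMap φ x θ) D (s, v) ∧ ∀ p, D p =
        (p.1, (θ' * p.1) • (stateMap φ x (θ s, v)).2 + expJac φ x (θ s, v) p.2) :=
    ⟨_, hasStrictFDerivAt_fst.prodMk (HasStrictFDerivAt.comp (s, v)
      (f := fun p : ℝ × E n => (θ p.1, p.2)) (hφ.hasStrictFDerivAt_stateMap_fst x (θ s, v)) h1),
      fun p => by simp [mul_comm]⟩
  have hinj : Function.Injective D := by
    refine (injective_iff_map_eq_zero _).2 fun p hp => ?_
    rw [hap, Prod.mk_eq_zero] at hp
    obtain ⟨h3, h4⟩ := hp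
    rw [h3, mul_zero, zero_smul, zero_add] at h4
    exact Prod.ext h3 ((injective_iff_map_eq_zero _).1 (hφ.expJac_injective hnc x hs) _ h4)
  obtain ⟨e, he⟩ := ContinuousLinearMap.exists_equiv_of_injective _ hinj
  rw [← he] at hD
  exact ⟨e, fun p => (DFunLike.congr_fun he p).trans (hap p), hD⟩

/-- The action along a lifted curve grows at most as fast as the action of the curve. -/
theorem IsELFlow.exists_hasDerivAt_radialAction_lift (hL : IsTonelliLagrangian n 2 L)
    (hφ : IsELFlow n 2 L φ) (hnc : NoConjugatePoints n φ) (x : E n) {θ : ℝ → ℝ} {θ' s : ℝ}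
    (hθ : HasStrictDerivAt θ θ' s) (hs : θ s ≠ 0) (hθ' : 0 < θ') {c w : ℝ → E n} {c' : E n}
    (hc : HasDerivAt c c' s) (hw : ContinuousAt w s)
    (hcw : ∀ᶠ σ in 𝓝 s, (stateMap φ x (θ σ, w σ)).1 = c σ) :
    ∃ d, HasDerivAt (fun σ => radialAction L φ x (θ σ, w σ)) d s ∧
      d ≤ θ' * L (c s, θ'⁻¹ • c') := by
  obtain ⟨e, he, hF⟩ := hφ.exists_hasStrictFDerivAt_expMap hnc x hθ hs (w s)
  have hW : ContinuousAt (fun σ => (σ, w σ)) s := continuousAt_id.prodMk hw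
  have hcs : (stateMap φ x (θ s, w s)).1 = c s := hcw.self_of_nhds
  have hinv : ∀ᶠ σ in 𝓝 s, hF.localInverse (expMap φ x θ) e (s, w s) (σ, c σ) = (σ, w σ) := by
    filter_upwards [hW.eventually hF.eventually_left_inverse, hcw] with σ h1 h2
    rwa [expMap, h2] at h1
  have hγ : HasDerivAt (fun σ => (σ, c σ)) ((1 : ℝ), c') s := (hasDerivAt_id s).prodMk hc
  have hinv' : HasFDerivAt (hF.localInverse (expMap φ x θ) e (s, w s))
      (e.symm : (ℝ × E n) →L[ℝ] (ℝ × E n)) (s, c s) := by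
    have := hF.to_localInverse.hasFDerivAt
    rwa [expMap, hcs] at this
  have hWd : HasDerivAt (fun σ => (σ, w σ)) (e.symm (1, c')) s :=
    (HasFDerivAt.comp_hasDerivAt s (f := fun σ => (σ, c σ)) hinv' hγ).congr_of_eventuallyEq
      (hinv.mono fun σ h => h.symm)
  obtain ⟨ω, hω⟩ : ∃ ω, e.symm (1, c') = ω := ⟨_, rfl⟩
  rw [hω] at hWd
  have hω' : e ω = (1, c') := by rw [← hω, e.apply_symm_apply]
  rw [he, Prod.mk.injEq] at hω'
  obtain ⟨h1, h2⟩ := hω'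
  rw [h1, mul_one] at h2
  have hwd : HasDerivAt w ω.2 s :=
    HasFDerivAt.comp_hasDerivAt s (f := fun σ => (σ, w σ)) hasFDerivAt_snd hWd
  have hA := HasFDerivAt.comp_hasDerivAt s (f := fun σ => (θ σ, w σ))
    (hφ.hasStrictFDerivAt_radialAction hL.smooth x (θ s, w s)).hasFDerivAt
    (hθ.hasDerivAt.prodMk hwd)
  refine ⟨_, hA, ?_⟩
  have h3 := hL.partialV_sub_le (c s) (stateMap φ x (θ s, w s)).2 (θ'⁻¹ • c')
  rw [← h2, smul_add, smul_smul, inv_mul_cancel₀ hθ'.ne', one_smul, add_sub_cancel_left,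
    map_smul, smul_eq_mul] at h3
  have h4 : stateMap φ x (θ s, w s) = (c s, (stateMap φ x (θ s, w s)).2) := by rw [← hcs]
  have h5 := mul_le_mul_of_nonneg_left h3 hθ'.le
  rw [mul_inv_cancel_left₀ hθ'.ne'] at h5
  rw [← h2]
  simp only [ContinuousLinearMap.coprod_apply, ContinuousLinearMap.smulRight_apply,
    ContinuousLinearMap.comp_apply, smul_add, smul_smul, inv_mul_cancel₀ hθ'.ne', one_smul]
  simp only [one_apply_eq_self, smul_eq_mul, hcs]
  rw [mul_sub, ← h4] at h5
  linarith

end Hadamard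

/-- A local homeomorphism lifts a path as soon as its partial lifts stay in a compact set. -/
theorem IsLocalHomeomorph.exists_lift_of_isCompact {X Y : Type*} [TopologicalSpace X] [T2Space X]
    [TopologicalSpace Y] [T2Space Y] {f : X → Y} (hf : IsLocalHomeomorph f) {γ : ℝ → Y}
    (hγ : Continuous γ) {x₀ : X} (hx₀ : f x₀ = γ 0) {K : Set X} (hK : IsCompact K)
    (hlift : ∀ (w : ℝ → X) (b : ℝ), b ∈ Icc (0 : ℝ) 1 → ContinuousOn w (Icc 0 b) → w 0 = x₀ →
      (∀ s ∈ Icc 0 b, f (w s) = γ s) → w b ∈ K) :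
    ∃ w : ℝ → X, ContinuousOn w (Icc 0 1) ∧ w 0 = x₀ ∧ ∀ s ∈ Icc (0 : ℝ) 1, f (w s) = γ s := by
  set P : Set (ℝ × X) := {p | p.1 ∈ Icc (0 : ℝ) 1 ∧ ∃ w : ℝ → X, ContinuousOn w (Icc 0 p.1) ∧
    w 0 = x₀ ∧ (∀ s ∈ Icc 0 p.1, f (w s) = γ s) ∧ w p.1 = p.2} with hP
  have hPK : closure P ⊆ Icc (0 : ℝ) 1 ×ˢ K := by
    refine closure_minimal ?_ (isClosed_Icc.prod hK.isClosed)
    rintro ⟨s, x⟩ ⟨hs, w, h1, h2, h3, h4⟩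
    refine ⟨hs, ?_⟩
    rw [← h4]
    exact hlift w s hs h1 h2 h3
  have hPγ : closure P ⊆ {p | f p.2 = γ p.1} := by
    refine closure_minimal ?_
      (isClosed_eq (hf.continuous.comp continuous_snd) (hγ.comp continuous_fst))
    rintro ⟨s, x⟩ ⟨hs, w, h1, h2, h3, h4⟩
    exact (congrArg f h4).symm.trans (h3 s (right_mem_Icc.2 hs.1))
  have h0 : ((0 : ℝ), x₀) ∈ P := by
    refine ⟨left_mem_Icc.2 zero_le_one, fun _ => x₀, continuousOn_const, rfl, fun s hs => ?_, rfl⟩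
    rw [Icc_self, mem_singleton_iff] at hs
    rw [hs, hx₀]
  have hPc : IsCompact (closure P) :=
    (isCompact_Icc.prod hK).of_isClosed_subset isClosed_closure hPK
  have hbdd : BddAbove (Prod.fst '' P) := ⟨1, by rintro _ ⟨p, hp, rfl⟩; exact hp.1.2⟩
  obtain ⟨⟨S, x⟩, hx, hS⟩ : sSup (Prod.fst '' P) ∈ Prod.fst '' closure P :=
    closure_minimal (image_mono subset_closure) (hPc.image continuous_fst).isClosed
      (csSup_mem_closure ⟨_, mem_image_of_mem _ h0⟩ hbdd)
  have hSx : f x = γ S := hPγ hx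
  replace hS : S = sSup (Prod.fst '' P) := hS
  have hS1 : S ∈ Icc (0 : ℝ) 1 := (hPK hx).1
  obtain ⟨e, hxe, rfl⟩ := hf x
  obtain ⟨δ, hδ, hball⟩ := Metric.mem_nhds_iff.1 ((e.open_target.preimage hγ).mem_nhds
    (show S ∈ γ ⁻¹' e.target by rw [mem_preimage, ← hSx]; exact e.map_source hxe))
  obtain ⟨⟨s, y⟩, ⟨hs, hy⟩, ⟨hs0, w, hw, hw0, hwγ, hwy⟩⟩ :=
    mem_closure_iff_nhds.1 hx _ (prod_mem_nhds (Metric.ball_mem_nhds S hδ)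
      (e.open_source.mem_nhds hxe))
  simp only at hs hy hs0 hw hwγ hwy
  have hs' := abs_lt.1 (by simpa [Real.dist_eq] using hs)
  set b := min 1 (S + δ / 2)
  have hSb : S ≤ b := le_min hS1.2 (by linarith)
  have hsS : s ≤ S := by
    rw [hS]
    exact le_csSup hbdd ⟨(s, y), ⟨hs0, w, hw, hw0, hwγ, hwy⟩, rfl⟩
  have hsb : s ≤ b := hsS.trans hSb
  have htarget : ∀ σ ∈ Icc s b, γ σ ∈ e.target := by
    intro σ hσ
    refine hball ?_
    have : σ ≤ S + δ / 2 := hσ.2.trans (min_le_right _ _)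
    rw [Metric.mem_ball, Real.dist_eq, abs_lt]
    exact ⟨by linarith [hσ.1, hs'.1], by linarith⟩
  set w' : ℝ → X := fun σ => if σ ≤ s then w σ else e.symm (γ σ)
  have hw'1 : EqOn w' w (Icc 0 s) := fun σ hσ => if_pos hσ.2
  have hw'2 : EqOn w' (fun σ => e.symm (γ σ)) (Icc s b) := by
    intro σ hσ
    rcases hσ.1.eq_or_lt with rfl | h
    · simp only [w', le_refl, if_true]
      rw [← hwγ s (right_mem_Icc.2 hs0.1), e.left_inv]
      rwa [hwy]
    · exact if_neg h.not_ge
  have hcont : ContinuousOn w' (Icc 0 b) := by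
    rw [← Icc_union_Icc_eq_Icc hs0.1 hsb]
    exact (hw.congr hw'1).union_of_isClosed
      ((e.continuousOn_symm.comp hγ.continuousOn htarget).congr hw'2) isClosed_Icc isClosed_Icc
  have hw'0 : w' 0 = x₀ := (hw'1 (left_mem_Icc.2 hs0.1)).trans hw0
  have hw'γ : ∀ σ ∈ Icc 0 b, e (w' σ) = γ σ := by
    intro σ hσ
    rcases le_total σ s with h | h
    · rw [hw'1 ⟨hσ.1, h⟩]
      exact hwγ σ ⟨hσ.1, h⟩
    · rw [hw'2 ⟨h, hσ.2⟩]
      exact e.right_inv (htarget σ ⟨h, hσ.2⟩)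
  have hbS : b ≤ S := by
    rw [hS]
    exact le_csSup hbdd ⟨(b, w' b), ⟨⟨hS1.1.trans hSb, min_le_left _ _⟩, w', hcont, hw'0, hw'γ,
      rfl⟩, rfl⟩
  have hb1 : b = 1 := by
    rcases min_choice 1 (S + δ / 2) with h | h
    · exact h
    · have : b = S + δ / 2 := h
      linarith
  rw [hb1] at hcont hw'γ
  exact ⟨w', hcont, hw'0, hw'γ⟩

section Hadamard

variable {n : ℕ} {L : E n × E n → ℝ} {φ : ℝ → E n × E n → E n × E n}

theorem IsELFlow.isLocalHomeomorph_expMap (hφ : IsELFlow n 2 L φ) (hnc : NoConjugatePoints n φ)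
    (x : E n) {θ : ℝ → ℝ} (hθ : ContDiff ℝ 1 θ) (hθ0 : ∀ s, θ s ≠ 0) :
    IsLocalHomeomorph (expMap φ x θ) := by
  intro p
  obtain ⟨e, -, he⟩ := hφ.exists_hasStrictFDerivAt_expMap hnc x
    (hθ.contDiffAt.hasStrictDerivAt (x := p.1) one_ne_zero) (hθ0 p.1) p.2
  exact ⟨he.toOpenPartialHomeomorph _, he.mem_toOpenPartialHomeomorph_source, rfl⟩

/-- Curves lift through the exponential map along increasing reparametrizations of time. -/
theorem IsELFlow.exists_lift_expMap (hL : IsTonelliLagrangian n 2 L) (hφ : IsELFlow n 2 L φ)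
    (hnc : NoConjugatePoints n φ) (x : E n) {θ : ℝ → ℝ} (hθ : ContDiff ℝ 1 θ)
    (hθ0 : ∀ s, 0 < θ s) (hθ' : ∀ s, 0 < deriv θ s) {c : ℝ → E n} (hc : ContDiff ℝ 1 c)
    {v₀ : E n} (hv₀ : (stateMap φ x (θ 0, v₀)).1 = c 0) :
    ∃ w : ℝ → E n, ContinuousOn w (Icc 0 1) ∧ w 0 = v₀ ∧
      ∀ s ∈ Icc (0 : ℝ) 1, (stateMap φ x (θ s, w s)).1 = c s := by
  have hmono : StrictMono θ := strictMono_of_deriv_pos hθ'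
  have hcont : Continuous fun s => deriv θ s * L (c s, (deriv θ s)⁻¹ • deriv c s) := by
    have h1 := hθ.continuous_deriv le_rfl
    exact h1.mul (hL.smooth.continuous.comp (hc.continuous.prodMk
      ((h1.inv₀ fun s => (hθ' s).ne').smul (hc.continuous_deriv le_rfl))))
  obtain ⟨B, hB⟩ := (isCompact_Icc (a := (0 : ℝ)) (b := 1)).exists_bound_of_continuousOn
    hcont.continuousOn
  obtain ⟨R, hR⟩ := hφ.exists_norm_le_of_radialAction_le hL x (hθ0 0) (θ 1)
    (radialAction L φ x (θ 0, v₀) + B)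
  have hK : ∀ (w : ℝ → ℝ × E n) (b : ℝ), b ∈ Icc (0 : ℝ) 1 → ContinuousOn w (Icc 0 b) →
      w 0 = (0, v₀) → (∀ s ∈ Icc 0 b, expMap φ x θ (w s) = (s, c s)) →
      w b ∈ Icc (0 : ℝ) 1 ×ˢ Metric.closedBall (0 : E n) R := by
    intro w b hb hw hw0 hwγ
    have h1 : ∀ s ∈ Icc (0 : ℝ) b, (w s).1 = s := fun s hs => congrArg Prod.fst (hwγ s hs)
    have h2 : ∀ s ∈ Icc (0 : ℝ) b, (stateMap φ x (θ s, (w s).2)).1 = c s := fun s hs => by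
      have := congrArg Prod.snd (hwγ s hs)
      simpa only [expMap, h1 s hs] using this
    have hbb := right_mem_Icc.2 hb.1
    refine ⟨by rw [h1 b hbb]; exact hb, ?_⟩
    rw [mem_closedBall_zero_iff]
    refine hR (θ b) _ (hmono.monotone hb.1) (hmono.monotone hb.2) ?_
    have hderiv : ∀ s ∈ Ioo 0 b, ∃ d,
        HasDerivAt (fun σ => radialAction L φ x (θ σ, (w σ).2)) d s ∧ d ≤ B := by
      intro s hs
      have hnhds := Icc_mem_nhds hs.1 hs.2
      obtain ⟨d, hd, hdB⟩ := hφ.exists_hasDerivAt_radialAction_lift hL hnc x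
        (hθ.contDiffAt.hasStrictDerivAt (x := s) one_ne_zero) (hθ0 s).ne' (hθ' s)
        (hc.differentiable one_ne_zero s).hasDerivAt
        (continuous_snd.continuousAt.comp (hw.continuousAt hnhds))
        (eventually_of_mem hnhds h2)
      exact ⟨d, hd, hdB.trans ((le_abs_self _).trans (hB s ⟨hs.1.le, hs.2.le.trans hb.2⟩))⟩
    have hA : Continuous (radialAction L φ x) := continuous_iff_continuousAt.2 fun p =>
      (hφ.hasStrictFDerivAt_radialAction hL.smooth x p).continuousAt
    have := (convex_Icc 0 b).image_sub_le_mul_sub_of_deriv_le (C := B)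
      (f := fun σ => radialAction L φ x (θ σ, (w σ).2))
      (hA.comp_continuousOn (hθ.continuous.continuousOn.prodMk
        (continuous_snd.comp_continuousOn hw)))
      (fun s hs => by
        rw [interior_Icc] at hs
        obtain ⟨d, hd, -⟩ := hderiv s hs
        exact hd.differentiableAt.differentiableWithinAt)
      (fun s hs => by
        rw [interior_Icc] at hs
        obtain ⟨d, hd, hdB⟩ := hderiv s hs
        rwa [hd.deriv])
      0 (left_mem_Icc.2 hb.1) b hbb hb.1
    have hB0 : 0 ≤ B := (norm_nonneg _).trans (hB 0 (left_mem_Icc.2 zero_le_one))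
    rw [hw0, sub_zero] at this
    nlinarith [hb.2]
  obtain ⟨w, hw, hw0, hwγ⟩ := (hφ.isLocalHomeomorph_expMap hnc x hθ fun s =>
    (hθ0 s).ne').exists_lift_of_isCompact (γ := fun s => (s, c s))
    (continuous_id.prodMk hc.continuous) (by rw [expMap, hv₀])
    (isCompact_Icc.prod (isCompact_closedBall (0 : E n) R)) hK
  have h1 : ∀ s ∈ Icc (0 : ℝ) 1, (w s).1 = s := fun s hs => congrArg Prod.fst (hwγ s hs)
  refine ⟨fun s => (w s).2, continuous_snd.comp_continuousOn hw, congrArg Prod.snd hw0, fun s hs => ?_⟩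
  have := congrArg Prod.snd (hwγ s hs)
  simpa only [expMap, h1 s hs] using this

end Hadamard

section Exponential

variable {n : ℕ} {L : E n × E n → ℝ} {φ : ℝ → E n × E n → E n × E n}

/-- Hadamard's theorem: without conjugate points, a unique extremal joins two points in a given
time. -/
theorem IsELFlow.bijective_stateMap_fst (hL : IsTonelliLagrangian n 2 L) (hφ : IsELFlow n 2 L φ)
    (hnc : NoConjugatePoints n φ) (x : E n) {T : ℝ} (hT : 0 < T) :
    Function.Bijective fun v => (stateMap φ x (T, v)).1 := by
  set θ : ℝ → ℝ := fun s => T * Real.exp (s - 1) with hθdef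
  have hθ : ContDiff ℝ 1 θ := contDiff_const.mul (Real.contDiff_exp.comp
    (contDiff_id.sub contDiff_const))
  have hθ0 : ∀ s, 0 < θ s := fun s => by positivity
  have hθ' : ∀ s, 0 < deriv θ s := fun s => by
    have : HasDerivAt θ (T * (Real.exp (s - 1) * 1)) s :=
      ((hasDerivAt_id s).sub_const 1).exp.const_mul T
    rw [this.deriv]
    positivity
  have hθ1 : θ 1 = T := by simp [hθdef]
  set c : E n → E n → ℝ → E n := fun v y s =>
    (stateMap φ x (θ s, v)).1 + s • (y - (stateMap φ x (T, v)).1) with hcdef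
  have hc : ∀ v y, ContDiff ℝ 1 (c v y) := fun v y =>
    (contDiff_fst.comp ((hφ.contDiff_stateMap x).comp (hθ.prodMk contDiff_const))).add
      (contDiff_id.smul contDiff_const)
  have hlift := fun v y => hφ.exists_lift_expMap hL hnc x hθ hθ0 hθ' (hc v y) (v₀ := v)
    (by simp [hcdef])
  choose w hw hw0 hwc using hlift
  have hc1 : ∀ v y, c v y 1 = y := fun v y => by simp [hcdef, hθ1]
  have hend : ∀ v y, (stateMap φ x (T, w v y 1)).1 = y := fun v y => by
    have := hwc v y 1 (right_mem_Icc.2 zero_le_one)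
    rwa [hθ1, hc1] at this
  refine ⟨fun v₀ v₁ hv => ?_, fun y => ⟨_, hend 0 y⟩⟩
  replace hv : (stateMap φ x (T, v₀)).1 = (stateMap φ x (T, v₁)).1 := hv
  obtain ⟨y, hy⟩ : ∃ y, y = (stateMap φ x (T, v₁)).1 := ⟨_, rfl⟩
  rw [← hy] at hv
  have hloc := hφ.isLocalHomeomorph_expMap hnc x hθ fun s => (hθ0 s).ne'
  have hsep : IsSeparatedMap (expMap φ x θ) := T2Space.isSeparatedMap _
  have hwI : ∀ v, Continuous fun s : unitInterval => ((s : ℝ), w v y s) := fun v =>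
    continuous_subtype_val.prodMk (continuousOn_iff_continuous_domRestrict.1 (hw v y))
  have hconst : ∀ v, (stateMap φ x (T, v)).1 = y → w v y 1 = v := by
    intro v hvy
    have := hsep.eq_of_comp_eq hloc.isLocallyInjective (hwI v)
      (continuous_subtype_val.prodMk continuous_const) (g₂ := fun s : unitInterval => ((s : ℝ), v))
      (funext fun s => by simp [expMap, hwc v y s s.2, hcdef, hvy]) 0 (by simp [hw0])
    exact congrArg Prod.snd (congrFun this 1)
  set V : unitInterval → E n := fun σ => (1 - (σ : ℝ)) • v₀ + (σ : ℝ) • v₁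
  have hV : Continuous V := by fun_prop
  have hf : Continuous fun p : unitInterval × unitInterval => ((p.1 : ℝ), c (V p.2) y p.1) := by
    have h1 := hφ.continuous_stateMap x
    have h2 : Continuous fun p : unitInterval × unitInterval =>
        (stateMap φ x (θ p.1, V p.2)).1 :=
      continuous_fst.comp (h1.comp ((hθ.continuous.comp
        (continuous_subtype_val.comp continuous_fst)).prodMk (hV.comp continuous_snd)))
    have h3 : Continuous fun p : unitInterval × unitInterval => (stateMap φ x (T, V p.2)).1 :=
      continuous_fst.comp (h1.comp (continuous_const.prodMk (hV.comp continuous_snd)))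
    exact (continuous_subtype_val.comp continuous_fst).prodMk
      (h2.add ((continuous_subtype_val.comp continuous_fst).smul (continuous_const.sub h3)))
  have hg := hloc.continuous_lift hsep ⟨_, hf⟩
    (g := fun p : unitInterval × unitInterval => ((p.1 : ℝ), w (V p.2) y p.1))
    (funext fun p => by simp [expMap, hwc _ y p.1 p.1.2])
    (by simpa [hw0] using continuous_const.prodMk hV) (fun σ => hwI (V σ))
  have hW : w (V 0) y 1 = w (V 1) y 1 := by
    have := hsep.const_of_comp hloc.isLocallyInjective
      (hg.comp (Continuous.prodMk_right (1 : unitInterval)))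
      (fun σ σ' => by simp [expMap, hend, hθ1]) 0 1
    exact congrArg Prod.snd this
  have hV0 : V 0 = v₀ := by simp [V]
  have hV1 : V 1 = v₁ := by simp [V]
  rwa [hV0, hV1, hconst v₀ hv, hconst v₁ hy.symm] at hW

end Exponential

theorem AbsolutelyContinuousOnInterval.of_dist_le {X Y : Type*} [PseudoMetricSpace X]
    [PseudoMetricSpace Y] {m : ℝ → X} {h : ℝ → Y} {a b : ℝ} (C : ℝ)
    (hm : AbsolutelyContinuousOnInterval m a b)
    (hh : ∀ s ∈ uIcc a b, ∀ t ∈ uIcc a b, dist (h s) (h t) ≤ C * dist (m s) (m t)) :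
    AbsolutelyContinuousOnInterval h a b := by
  have h1 : Tendsto _ _ _ := Tendsto.const_mul C hm
  rw [mul_zero] at h1
  refine squeeze_zero' (Eventually.of_forall fun E => Finset.sum_nonneg fun _ _ => dist_nonneg)
    ?_ h1
  filter_upwards [mem_inf_of_right (mem_principal_self _)] with E hE
  rw [Finset.mul_sum]
  exact Finset.sum_le_sum fun i hi => hh _ (hE.1 i hi).1 _ (hE.1 i hi).2

/-- The pair `(u, Q)` of a calibrating function and its velocity field on positive times:
`du (s, z) = L (y, Q) s + ∂ᵥL (y, Q) (z - s Q)`. -/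
structure IsCalibration {n : ℕ} (L : E n × E n → ℝ) (u : ℝ × E n → ℝ) (Q : ℝ × E n → E n) :
    Prop where
  continuousOn : ContinuousOn Q {p | 0 < p.1}
  hasFDerivAt : ∀ p : ℝ × E n, 0 < p.1 → HasFDerivAt u
    (((1 : ℝ →L[ℝ] ℝ).smulRight (L (p.2, Q p) - partialV n L p.2 (Q p) (Q p))).coprod
      (partialV n L p.2 (Q p))) p

section Calibration

variable {n : ℕ} {L : E n × E n → ℝ} {φ : ℝ → E n × E n → E n × E n}

/-- The action from a base point is a calibration. -/
theorem IsELFlow.exists_isCalibration (hL : IsTonelliLagrangian n 2 L) (hφ : IsELFlow n 2 L φ)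
    (hnc : NoConjugatePoints n φ) (x : E n) :
    ∃ (u : ℝ × E n → ℝ) (Q : ℝ × E n → E n), IsCalibration L u Q ∧ ∀ t v, 0 < t →
      u (t, (stateMap φ x (t, v)).1) = radialAction L φ x (t, v) ∧
      Q (t, (stateMap φ x (t, v)).1) = (stateMap φ x (t, v)).2 := by
  have hbij := fun (t : ℝ) (ht : 0 < t) => hφ.bijective_stateMap_fst hL hnc x ht
  set W : ℝ × E n → E n := fun p => Function.invFun (fun v => (stateMap φ x (p.1, v)).1) p.2
    with hWdef
  have hWr : ∀ p : ℝ × E n, 0 < p.1 → (stateMap φ x (p.1, W p)).1 = p.2 := fun p hp =>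
    Function.rightInverse_invFun (hbij p.1 hp).2 p.2
  have hWl : ∀ t v, 0 < t → W (t, (stateMap φ x (t, v)).1) = v := fun t v ht =>
    Function.leftInverse_invFun (hbij t ht).1 v
  have hinv : ∀ p : ℝ × E n, 0 < p.1 → ∃ e : (ℝ × E n) ≃L[ℝ] (ℝ × E n),
      (∀ z, e z = (z.1, z.1 • (stateMap φ x (p.1, W p)).2 + expJac φ x (p.1, W p) z.2)) ∧
      HasFDerivAt (fun q : ℝ × E n => (q.1, W q)) (e.symm : (ℝ × E n) →L[ℝ] (ℝ × E n)) p := by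
    intro p hp
    obtain ⟨e, he, hF⟩ := hφ.exists_hasStrictFDerivAt_expMap hnc x
      (hasStrictDerivAt_id p.1) (s := p.1) hp.ne' (W p)
    refine ⟨e, fun z => by simpa using he z, ?_⟩
    have h1 : ∀ᶠ q : ℝ × E n in 𝓝 (p.1, W p),
        ((expMap φ x id q).1, W (expMap φ x id q)) = q := by
      filter_upwards [(isOpen_Ioi.preimage continuous_fst).mem_nhds
        (show (p.1, W p) ∈ Prod.fst ⁻¹' Ioi (0 : ℝ) from hp)] with q hq
      exact Prod.ext rfl (hWl q.1 q.2 hq)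
    have h2 := (hF.to_local_left_inverse (g := fun q : ℝ × E n => (q.1, W q)) h1).hasFDerivAt
    have h3 : expMap φ x id (p.1, W p) = p := Prod.ext rfl (hWr p hp)
    rwa [h3] at h2
  refine ⟨fun p => radialAction L φ x (p.1, W p), fun p => (stateMap φ x (p.1, W p)).2,
    ⟨?_, ?_⟩, ?_⟩
  · intro p hp
    obtain ⟨e, -, he⟩ := hinv p hp
    exact ((continuous_snd.comp (hφ.continuous_stateMap x)).continuousAt.comp
      he.continuousAt).continuousWithinAt
  · intro p hp
    obtain ⟨e, hea, he⟩ := hinv p hp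
    have h1 := HasFDerivAt.comp p (f := fun q : ℝ × E n => (q.1, W q))
      (hφ.hasStrictFDerivAt_radialAction hL.smooth x (p.1, W p)).hasFDerivAt he
    have h2 : (((1 : ℝ →L[ℝ] ℝ).smulRight (L (p.2, (stateMap φ x (p.1, W p)).2) -
        partialV n L p.2 (stateMap φ x (p.1, W p)).2 (stateMap φ x (p.1, W p)).2)).coprod
        (partialV n L p.2 (stateMap φ x (p.1, W p)).2)) =
        (((1 : ℝ →L[ℝ] ℝ).smulRight (L (stateMap φ x (p.1, W p)))).coprod
        ((partialV n L (stateMap φ x (p.1, W p)).1 (stateMap φ x (p.1, W p)).2).comp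
        (expJac φ x (p.1, W p)))).comp (e.symm : (ℝ × E n) →L[ℝ] (ℝ × E n)) := by
      refine ContinuousLinearMap.ext fun z => ?_
      obtain ⟨ζ, rfl⟩ := e.surjective z
      have h3 : L (stateMap φ x (p.1, W p)) = L (p.2, (stateMap φ x (p.1, W p)).2) := by
        rw [← hWr p hp]
      rw [h3, hWr p hp, ContinuousLinearMap.comp_apply, ContinuousLinearEquiv.coe_coe,
        e.symm_apply_apply, hea]
      simp only [ContinuousLinearMap.coprod_apply, ContinuousLinearMap.smulRight_apply,
        ContinuousLinearMap.comp_apply, one_apply_eq_self, smul_eq_mul, map_add, map_smul]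
      ring
    rw [h2]
    exact h1
  · intro t v ht
    simp only [hWl t v ht, true_and]

theorem continuousOn_curveOf (x : E n) {g : ℝ → E n} {T : ℝ} (hT : 0 ≤ T)
    (hg : IntervalIntegrable g volume 0 T) : ContinuousOn (curveOf n x g) (Icc 0 T) := by
  have := intervalIntegral.continuousOn_primitive_interval' hg left_mem_uIcc
  rw [uIcc_of_le hT] at this
  exact continuousOn_const.add this

/-- A calibration grows at most as fast as the action along absolutely continuous curves. -/
theorem IsCalibration.sub_le_integral (hL : IsTonelliLagrangian n 2 L) {u : ℝ × E n → ℝ}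
    {Q : ℝ × E n → E n} (hu : IsCalibration L u Q) {a T : ℝ} (ha : 0 < a) (hT : 0 ≤ T) (x : E n)
    {g : ℝ → E n} (hg : IntervalIntegrable g volume 0 T)
    (hLg : IntervalIntegrable (fun s => L (curveOf n x g s, g s)) volume 0 T) :
    u (a + T, curveOf n x g T) - u (a, x) ≤ ∫ s in (0:ℝ)..T, L (curveOf n x g s, g s) := by
  set c := curveOf n x g with hcdef
  have hc : ContinuousOn c (Icc 0 T) := continuousOn_curveOf x hT hg
  obtain ⟨R, hR⟩ := isCompact_Icc.exists_bound_of_continuousOn hc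
  set K : Set (ℝ × E n) := Icc a (a + T) ×ˢ Metric.closedBall 0 R
  have hKc : IsCompact K := isCompact_Icc.prod (isCompact_closedBall _ _)
  have hKpos : K ⊆ {p | 0 < p.1} := fun p hp => ha.trans_le hp.1.1
  have hmem : ∀ s ∈ Icc 0 T, (a + s, c s) ∈ K := fun s hs =>
    ⟨⟨by linarith [hs.1], by linarith [hs.2]⟩, by simpa using hR s hs⟩
  have hQ := hu.continuousOn.mono hKpos
  have hyQ : ContinuousOn (fun p : ℝ × E n => (p.2, Q p)) K := continuousOn_snd.prodMk hQ
  have hV : ContinuousOn (fun p : ℝ × E n => partialV n L p.2 (Q p)) K :=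
    (contDiff_partialV hL.smooth).continuous.comp_continuousOn hyQ
  have hlin : ContinuousOn (fun p : ℝ × E n => L (p.2, Q p) - partialV n L p.2 (Q p) (Q p)) K :=
    (hL.smooth.continuous.comp_continuousOn hyQ).sub (hV.clm_apply hQ)
  obtain ⟨B₁, hB₁⟩ := hKc.exists_bound_of_continuousOn hV
  obtain ⟨B₂, hB₂⟩ := hKc.exists_bound_of_continuousOn hlin
  have hlip : ∀ p ∈ K, ∀ q ∈ K, ‖u q - u p‖ ≤ (B₂ + B₁) * ‖q - p‖ := by
    intro p hp q hq
    refine Convex.norm_image_sub_le_of_norm_hasFDerivWithin_le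
      (fun z hz => (hu.hasFDerivAt z (hKpos hz)).hasFDerivWithinAt) (fun z hz => ?_)
      ((convex_Icc _ _).prod (convex_closedBall _ _)) hp hq
    refine ContinuousLinearMap.opNorm_le_bound _
      (add_nonneg ((norm_nonneg _).trans (hB₂ z hz)) ((norm_nonneg _).trans (hB₁ z hz)))
      fun y => ?_
    rw [ContinuousLinearMap.coprod_apply, ContinuousLinearMap.smulRight_apply, add_mul]
    refine (norm_add_le _ _).trans (add_le_add ?_ ?_)
    · rw [norm_smul, mul_comm]
      exact mul_le_mul (hB₂ z hz) (norm_fst_le y) (norm_nonneg _)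
        ((norm_nonneg _).trans (hB₂ z hz))
    · exact ((partialV n L z.2 (Q z)).le_opNorm _).trans (mul_le_mul (hB₁ z hz) (norm_snd_le y)
        (norm_nonneg _) ((norm_nonneg _).trans (hB₁ z hz)))
  have hB : 0 ≤ B₂ + B₁ := by
    have h0 := hmem 0 (left_mem_Icc.2 hT)
    exact add_nonneg ((norm_nonneg _).trans (hB₂ _ h0)) ((norm_nonneg _).trans (hB₁ _ h0))
  set h : ℝ → ℝ := fun s => u (a + s, c s) with hhdef
  have hm : IntervalIntegrable (fun s => 1 + ‖g s‖) volume 0 T :=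
    intervalIntegrable_const.add hg.norm
  have hac : AbsolutelyContinuousOnInterval h 0 T := by
    refine (hm.absolutelyContinuousOnInterval_intervalIntegral left_mem_uIcc).of_dist_le
      (B₂ + B₁) fun s hs t ht => ?_
    have hsub : ∀ t ∈ uIcc 0 T, uIcc 0 t ⊆ uIcc 0 T := fun t ht =>
      uIcc_subset_uIcc left_mem_uIcc ht
    rw [dist_comm, dist_comm _ (∫ v in (0:ℝ)..t, _), dist_eq_norm, dist_eq_norm,
      intervalIntegral.integral_interval_sub_left (hm.mono_set (hsub t ht))
      (hm.mono_set (hsub s hs))]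
    have hst : uIcc s t ⊆ uIcc 0 T := uIcc_subset_uIcc hs ht
    rw [uIcc_of_le hT] at hs ht
    refine (hlip _ (hmem s hs) _ (hmem t ht)).trans (mul_le_mul_of_nonneg_left ?_ hB)
    rw [Prod.mk_sub_mk, add_sub_add_left_eq_sub]
    have hc' : c t - c s = ∫ v in s..t, g v := by
      simp only [hcdef, curveOf, add_sub_add_left_eq_sub]
      rw [← uIcc_of_le hT] at hs ht
      exact intervalIntegral.integral_interval_sub_left (hg.mono_set (hsub t ht))
        (hg.mono_set (hsub s hs))
    have ht' : t - s = ∫ _ in s..t, (1 : ℝ) := by simp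
    refine max_le ?_ ?_
    · change ‖t - s‖ ≤ _
      rw [ht']
      refine intervalIntegral.norm_integral_le_abs_of_norm_le (ae_of_all _ fun v => ?_)
        (hm.mono_set hst)
      simp
    · change ‖c t - c s‖ ≤ _
      rw [hc']
      exact intervalIntegral.norm_integral_le_abs_of_norm_le
        (ae_of_all _ fun v => by linarith) (hm.mono_set hst)
  have hae : ∀ᵐ s : ℝ, s ∈ Ioo 0 T → deriv h s ≤ L (c s, g s) := by
    filter_upwards [hg.ae_hasDerivAt_integral] with s hs hsT
    have hcd : HasDerivAt c (g s) s := by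
      have := (hs (by rw [uIcc_of_le hT]; exact Ioo_subset_Icc_self hsT) 0 left_mem_uIcc).const_add x
      exact this
    have hp : (0 : ℝ) < ((a + s, c s) : ℝ × E n).1 := add_pos ha hsT.1
    have hd := HasFDerivAt.comp_hasDerivAt s (f := fun s => (a + s, c s)) (hu.hasFDerivAt _ hp)
      (((hasDerivAt_id s).const_add a).prodMk hcd)
    have hd' := hd.deriv
    have h1 := hL.partialV_sub_le (c s) (Q (a + s, c s)) (g s)
    rw [map_sub] at h1
    change deriv h s = _ at hd'
    rw [hd']
    simp only [ContinuousLinearMap.coprod_apply, ContinuousLinearMap.smulRight_apply,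
      one_apply_eq_self, one_smul]
    linarith
  have h0 : h 0 = u (a, x) := by simp [hhdef, hcdef, curveOf]
  have hT' : h T = u (a + T, c T) := rfl
  rw [← h0, ← hT', ← hac.integral_deriv_eq_sub]
  refine intervalIntegral.integral_mono_ae_restrict hT hac.intervalIntegrable_deriv hLg ?_
  rw [← restrict_Ioo_eq_restrict_Icc]
  exact (ae_restrict_iff' measurableSet_Ioo).2 hae

end Calibration

section Cost

variable {n : ℕ} {L : E n × E n → ℝ} {φ : ℝ → E n × E n → E n × E n}

theorem Acost_le (hL : IsTonelliLagrangian n 2 L) {T : ℝ} (hT : 0 ≤ T) (x : E n) {g : ℝ → E n}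
    (hg : IntervalIntegrable g volume 0 T)
    (hLg : IntervalIntegrable (fun s => L (curveOf n x g s, g s)) volume 0 T) :
    Acost n L T x (curveOf n x g T) ≤ ∫ s in (0:ℝ)..T, L (curveOf n x g s, g s) := by
  obtain ⟨C, -, hC⟩ := hL.exists_norm_sub_le
  refine csInf_le ⟨∫ _ in (0:ℝ)..T, -C, ?_⟩ ⟨g, hg, rfl, hLg, rfl⟩
  rintro _ ⟨g', -, -, h, rfl⟩
  refine intervalIntegral.integral_mono_on hT intervalIntegrable_const h fun s _ => ?_
  have h1 := hC (curveOf n x g' s) (g' s)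
  have h2 := norm_nonneg (g' s)
  linarith

theorem curveOf_deriv {γ : ℝ → E n} (hγ : ContDiff ℝ 1 γ) : curveOf n (γ 0) (deriv γ) = γ := by
  funext s
  have h := hγ.continuous_deriv le_rfl
  rw [curveOf, intervalIntegral.integral_deriv_eq_sub
    (fun t _ => (hγ.differentiable one_ne_zero) t) (h.intervalIntegrable _ _)]
  abel

theorem Acost_le_of_contDiff (hL : IsTonelliLagrangian n 2 L) {T : ℝ} (hT : 0 ≤ T) {γ : ℝ → E n}
    (hγ : ContDiff ℝ 1 γ) :
    Acost n L T (γ 0) (γ T) ≤ ∫ s in (0:ℝ)..T, L (γ s, deriv γ s) := by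
  have hd := hγ.continuous_deriv le_rfl
  have h := Acost_le hL hT (γ 0) (hd.intervalIntegrable _ _) (by
    rw [curveOf_deriv hγ]
    exact (hL.smooth.continuous.comp (hγ.continuous.prodMk hd)).intervalIntegrable _ _)
  rwa [curveOf_deriv hγ] at h

theorem IsCalibration.sub_le_Acost (hL : IsTonelliLagrangian n 2 L) {u : ℝ × E n → ℝ}
    {Q : ℝ × E n → E n} (hu : IsCalibration L u Q) {a T : ℝ} (ha : 0 < a) (hT : 0 < T)
    (x y : E n) : u (a + T, y) - u (a, x) ≤ Acost n L T x y := by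
  refine le_csInf ?_ ?_
  · have hc : Continuous (curveOf n x fun _ => T⁻¹ • (y - x)) := by
      unfold curveOf
      fun_prop
    refine ⟨_, fun _ => T⁻¹ • (y - x), intervalIntegrable_const, ?_,
      (hL.smooth.continuous.comp (hc.prodMk continuous_const)).intervalIntegrable _ _, rfl⟩
    simp [curveOf, ← smul_sub, smul_smul, hT.ne']
  · rintro _ ⟨g, hg, rfl, hLg, rfl⟩
    exact hu.sub_le_integral hL ha hT.le x hg hLg

theorem Acost_add_intVec (hL : IsTonelliLagrangian n 2 L) (T : ℝ) (x y : E n) (m : Fin n → ℤ) :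
    Acost n L T (x + intVec m) (y + intVec m) = Acost n L T x y := by
  have h : ∀ g s, curveOf n (x + intVec m) g s = curveOf n x g s + intVec m := fun g s => by
    simp only [curveOf]
    abel
  simp only [Acost, h, hL.periodic, add_left_inj]

/-- Every extremal is calibrated by the action from its position at time `-1`. -/
theorem IsExtremal.exists_isCalibration (hL : IsTonelliLagrangian n 2 L)
    (hφ : IsELFlow n 2 L φ) (hnc : NoConjugatePoints n φ) {γ : ℝ → E n}
    (hγ : IsExtremal n L γ) :
    ∃ (u : ℝ × E n → ℝ) (Q : ℝ × E n → E n), IsCalibration L u Q ∧ ∀ t, 0 ≤ t →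
      Q (1 + t, γ t) = deriv γ t ∧
      u (1 + t, γ t) - u (1, γ 0) = ∫ s in (0:ℝ)..t, L (γ s, deriv γ s) := by
  obtain ⟨u, Q, hu, h⟩ := hφ.exists_isCalibration hL hnc (γ (-1))
  have hst : ∀ t, stateMap φ (γ (-1)) (t, deriv γ (-1)) = (γ (t + -1), deriv γ (t + -1)) := by
    intro t
    have := hφ.eq_state hL (hγ.comp_add_right (-1)) t
    simp only [deriv_comp_add_right, zero_add] at this
    exact this
  have hst' : ∀ t, stateMap φ (γ (-1)) (1 + t, deriv γ (-1)) = (γ t, deriv γ t) := by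
    intro t
    rw [hst, add_neg_cancel_comm]
  have hc : Continuous fun s => L (γ s, deriv γ s) := hL.smooth.continuous.comp hγ.continuous_state
  have hrad : ∀ t, radialAction L φ (γ (-1)) (1 + t, deriv γ (-1)) =
      ∫ s in (-1:ℝ)..t, L (γ s, deriv γ s) := by
    intro t
    simp only [radialAction, hst]
    rw [intervalIntegral.integral_comp_add_right (fun s => L (γ s, deriv γ s)), zero_add,
      add_neg_cancel_comm]
  have key : ∀ t, 0 ≤ t → u (1 + t, γ t) = ∫ s in (-1:ℝ)..t, L (γ s, deriv γ s) ∧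
      Q (1 + t, γ t) = deriv γ t := by
    intro t ht
    have := h (1 + t) (deriv γ (-1)) (by linarith)
    rwa [hst', hrad] at this
  refine ⟨u, Q, hu, fun t ht => ⟨(key t ht).2, ?_⟩⟩
  have h0 := (key 0 le_rfl).1
  rw [add_zero] at h0
  rw [(key t ht).1, h0, intervalIntegral.integral_interval_sub_left
    (hc.intervalIntegrable _ _) (hc.intervalIntegrable _ _)]

/-- Extremals without conjugate points minimize the action. -/
theorem IsExtremal.Acost_eq (hL : IsTonelliLagrangian n 2 L)
    (hφ : IsELFlow n 2 L φ) (hnc : NoConjugatePoints n φ) {γ : ℝ → E n}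
    (hγ : IsExtremal n L γ) {T : ℝ} (hT : 0 < T) :
    Acost n L T (γ 0) (γ T) = ∫ s in (0:ℝ)..T, L (γ s, deriv γ s) := by
  obtain ⟨u, Q, hu, h⟩ := hγ.exists_isCalibration hL hφ hnc
  refine le_antisymm (Acost_le_of_contDiff hL hT.le (hγ.1.of_le one_le_two)) ?_
  rw [← (h T hT.le).2]
  exact hu.sub_le_Acost hL one_pos hT _ _

theorem IsELFlow.exists_isExtremal (hL : IsTonelliLagrangian n 2 L)
    (hφ : IsELFlow n 2 L φ) (hnc : NoConjugatePoints n φ) {T : ℝ} (hT : 0 < T) (x y : E n) :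
    ∃ γ : ℝ → E n, IsExtremal n L γ ∧ γ 0 = x ∧ γ T = y := by
  obtain ⟨v, hv⟩ := (hφ.bijective_stateMap_fst hL hnc x hT).2 y
  exact ⟨_, (hφ.2.2 x v).1, by simp [hφ.2.1], hv⟩

theorem IsELFlow.upperSemicontinuous_Acost (hL : IsTonelliLagrangian n 2 L)
    (hφ : IsELFlow n 2 L φ) (hnc : NoConjugatePoints n φ) {T : ℝ} (hT : 0 < T) (w : E n) :
    UpperSemicontinuous fun x => Acost n L T x (x + w) := by
  intro y c hc
  obtain ⟨γ, hγ, hγ0, hγT⟩ := hφ.exists_isExtremal hL hnc hT y (y + w)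
  have hd := hγ.1.continuous_deriv one_le_two
  have hcont : Continuous fun x : E n => ∫ s in (0:ℝ)..T, L (γ s + (x - y), deriv γ s) := by
    refine intervalIntegral.continuous_parametric_intervalIntegral_of_continuous'
      (f := fun x s => L (γ s + (x - y), deriv γ s)) ?_ 0 T
    have h1 := hL.smooth.continuous
    have h2 := hγ.1.continuous
    unfold Function.uncurry
    fun_prop
  have hval : ∫ s in (0:ℝ)..T, L (γ s + (y - y), deriv γ s) < c := by
    have := hγ.Acost_eq hL hφ hnc hT
    rw [hγ0, hγT] at this
    simpa [← this] using hc
  filter_upwards [hcont.continuousAt.eventually_lt_const hval] with x hx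
  refine lt_of_le_of_lt ?_ hx
  have h := Acost_le_of_contDiff hL hT.le (γ := fun s => γ s + (x - y))
    ((hγ.1.of_le one_le_two).add contDiff_const)
  have e : y + w + (x - y) = x + w := by abel
  simpa [hγ0, hγT, deriv_add_const', e] using h

/-- The extremal between a maximum point `x` of the action to `x + r` and `x + r` closes up. -/
theorem IsExtremal.add_eq_of_isMax (hL : IsTonelliLagrangian n 2 L)
    (hφ : IsELFlow n 2 L φ) (hnc : NoConjugatePoints n φ) {γ : ℝ → E n}
    (hγ : IsExtremal n L γ) {T : ℝ} (hT : 0 < T) {r : Fin n → ℤ} (hr : γ T = γ 0 + intVec r)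
    (hmax : ∀ x, Acost n L T x (x + intVec r) ≤ Acost n L T (γ 0) (γ 0 + intVec r)) (t : ℝ) :
    γ (t + T) = γ t + intVec r := by
  obtain ⟨u, Q, hu, h⟩ := hγ.exists_isCalibration hL hφ hnc
  have hA := hγ.Acost_eq hL hφ hnc hT
  have hQ0 := (h 0 le_rfl).1
  obtain ⟨hQT, huT⟩ := h T hT.le
  rw [add_zero] at hQ0
  have hlm : IsLocalMax (fun x => u (1 + T, x + intVec r) - u (1, x)) (γ 0) := by
    refine Eventually.of_forall fun x => ?_
    have := hu.sub_le_Acost hL one_pos hT x (x + intVec r)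
    have := hmax x
    simp only [← hr] at *
    linarith
  have h1 := HasFDerivAt.comp (γ 0) (f := fun x : E n => (1 + T, x + intVec r))
    (hu.hasFDerivAt (1 + T, γ 0 + intVec r) (by positivity))
    ((hasFDerivAt_const (1 + T) (γ 0)).prodMk ((hasFDerivAt_id (γ 0)).add_const (intVec r)))
  have h2 := HasFDerivAt.comp (γ 0) (f := fun x : E n => ((1 : ℝ), x))
    (hu.hasFDerivAt (1, γ 0) one_pos)
    ((hasFDerivAt_const (1 : ℝ) (γ 0)).prodMk (hasFDerivAt_id (γ 0)))
  have h3 := hlm.hasFDerivAt_eq_zero (h1.sub h2)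
  have h4 : partialV n L (γ 0) (deriv γ T) = partialV n L (γ 0) (deriv γ 0) := by
    refine ContinuousLinearMap.ext fun w => ?_
    have h5 := DFunLike.congr_fun h3 w
    simp only [sub_apply, ContinuousLinearMap.comp_apply,
      ContinuousLinearMap.prod_apply, ContinuousLinearMap.coprod_apply, ← hr, hQT, hQ0,
      zero_apply, map_zero, zero_add,
      ContinuousLinearMap.id_apply, sub_eq_zero] at h5
    rwa [hr, hL.partialV_periodic] at h5
  have h6 := hL.partialV_injective _ h4
  refine congrFun ((hγ.comp_add_right T).eq_of_eq hL (hγ.add_intVec hL r) 0 ?_ ?_) t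
  · simpa using hr
  · rw [deriv_comp_add_right, deriv_add_const']
    simpa using h6

theorem IsELFlow.Acost_le_Acost_of_isMax (hL : IsTonelliLagrangian n 2 L)
    (hφ : IsELFlow n 2 L φ) (hnc : NoConjugatePoints n φ) {T : ℝ} (hT : 0 < T) {r : Fin n → ℤ}
    {x : E n}
    (hmax : ∀ y, Acost n L T y (y + intVec r) ≤ Acost n L T x (x + intVec r)) (y : E n) :
    Acost n L T x (x + intVec r) ≤ Acost n L T y (y + intVec r) := by
  obtain ⟨γ, hγ, rfl, hγT⟩ := hφ.exists_isExtremal hL hnc hT x (x + intVec r)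
  have hper := hγ.add_eq_of_isMax hL hφ hnc hT hγT hmax
  obtain ⟨u, Q, hu, h⟩ := hγ.exists_isCalibration hL hφ hnc
  set M := Acost n L T (γ 0) (γ 0 + intVec r) with hM
  set M' := Acost n L T y (y + intVec r) with hM'
  have hvec : ∀ j : ℕ, intVec ((j + 1) • r) = intVec (j • r) + (intVec r : E n) := fun j => by
    ext i
    simp [intVec, add_mul]
  have hγj : ∀ j : ℕ, γ (j * T) = γ 0 + intVec (j • r) := by
    intro j
    induction j with
    | zero => ext i; simp [intVec]
    | succ j ih =>
      rw [Nat.cast_succ, add_one_mul, hper, ih, hvec, add_assoc]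
  have hpos : ∀ j : ℕ, (0 : ℝ) ≤ j * T := fun j => by positivity
  have huj : ∀ j : ℕ, u (1 + j * T, γ 0 + intVec (j • r)) = u (1, γ 0) + j * M := by
    intro j
    have hF : Function.Periodic (fun s => L (γ s, deriv γ s)) T := by
      intro s
      have hd : deriv γ (s + T) = deriv γ s := by
        rw [← congrFun (deriv_comp_add_right γ T) s, funext hper, deriv_add_const']
      simp only [hper, hd, hL.periodic]
    have hc : Continuous fun s => L (γ s, deriv γ s) :=
      hL.smooth.continuous.comp hγ.continuous_state
    have h1 := hF.intervalIntegral_add_zsmul_eq j 0 fun _ _ => hc.intervalIntegrable _ _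
    rw [zero_add, zero_add, ← hγ.Acost_eq hL hφ hnc hT, hγT, ← hM] at h1
    have h2 := (h (j * T) (hpos j)).2
    rw [hγj] at h2
    simp only [zsmul_eq_mul, Int.cast_natCast] at h1
    linarith
  have hb : ∀ j : ℕ, u (1 + j * T, y + intVec (j • r)) ≤ u (1, y) + j * M' := by
    intro j
    induction j with
    | zero =>
      have : (intVec (0 • r) : E n) = 0 := by ext i; simp [intVec]
      rw [this]
      simp
    | succ j ih =>
      have h1 := hu.sub_le_Acost hL (a := 1 + j * T) (by linarith [hpos j]) hT
        (y + intVec (j • r)) (y + intVec r + intVec (j • r))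
      rw [Acost_add_intVec hL, ← hM'] at h1
      rw [hvec, add_comm (intVec (j • r)), ← add_assoc, Nat.cast_succ, add_one_mul, ← add_assoc]
      linarith
  set C := Acost n L T y (γ 0 + intVec r)
  have hj : ∀ j : ℕ, (j : ℝ) * (M - M') ≤ u (1, y) + C - u (1, γ 0) - M := by
    intro j
    have h1 := hu.sub_le_Acost hL (a := 1 + j * T) (by linarith [hpos j]) hT
      (y + intVec (j • r)) (γ 0 + intVec r + intVec (j • r))
    rw [Acost_add_intVec hL] at h1
    have h2 := huj (j + 1)
    rw [hvec, add_comm (intVec (j • r)), ← add_assoc, Nat.cast_succ, add_one_mul,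
      ← add_assoc] at h2
    have h3 := hb j
    linarith
  by_contra! hlt
  obtain ⟨j, hj'⟩ := exists_nat_gt ((u (1, y) + C - u (1, γ 0) - M) / (M - M'))
  rw [div_lt_iff₀ (sub_pos.2 hlt)] at hj'
  exact (hj j).not_gt hj'

end Cost

end

/-- For a Tonelli Lagrangian without conjugate points, `T > 0` and
`r ∈ ℤⁿ`, the function `f x = 𝒜_T(x, x + r)` is constant on `ℝⁿ`. -/
theorem action_function_constant (n k : ℕ) (hn : 1 ≤ n) (hk : 2 ≤ k)
    (L : E n × E n → ℝ) (hL : IsTonelliLagrangian n (k : ℕ∞) L)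
    (φ : ℝ → E n × E n → E n × E n) (hφ : IsELFlow n k L φ)
    (hnc : NoConjugatePoints n φ)
    (T : ℝ) (hT : 0 < T) (r : Fin n → ℤ) :
    ∀ x y : E n, Acost n L T x (x + intVec r) = Acost n L T y (y + intVec r) := by
  have hL : IsTonelliLagrangian n 2 L :=
    ⟨hL.smooth.of_le (by exact_mod_cast hk), hL.periodic, hL.superlinear, hL.posdef⟩
  have hk1 : 1 ≤ k - 1 := by omega
  have hφ : IsELFlow n 2 L φ := ⟨hφ.1.of_le (by exact_mod_cast hk1), hφ.2⟩
  have husc := hφ.upperSemicontinuous_Acost hL hnc hT (intVec r)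
  obtain ⟨x₀, -, hx₀⟩ := (husc.upperSemicontinuousOn _).exists_isMaxOn
    ⟨0, Metric.mem_closedBall_self zero_le_one⟩ (isCompact_closedBall (0 : E n) 1)
  have hmax : ∀ y, Acost n L T y (y + intVec r) ≤ Acost n L T x₀ (x₀ + intVec r) := by
    intro y
    obtain ⟨m, hm⟩ := exists_intVec_add_norm_le y
    have h := isMaxOn_iff.1 hx₀ (y + intVec m) (by simpa using hm)
    beta_reduce at h
    rwa [add_right_comm, Acost_add_intVec hL] at h
  have heq : ∀ y, Acost n L T y (y + intVec r) = Acost n L T x₀ (x₀ + intVec r) := fun y =>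
    le_antisymm (hmax y) (hφ.Acost_le_Acost_of_isMax hL hnc hT hmax y)
  intro x y
  rw [heq x, heq y]

end
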